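/- arXiv:2403.18763 — 2 statements merged into one kernel-verified Lean document; each statement's English description precedes it below -/
import Mathlib

section
/- (Weight-zero case of the first exact sequence of Lemma 4.2 / lem:gr-ex.) Assume O is henselian and admits a coefficient field K ⊆ O (e.g. O = K[[z]]). Let n ≥ 1 and r ≥ 2. If a ∈ Fil^p_r Wₙ(L) satisfies F^{n−1}d(a) = Σ_{i=0}^{n−1} a_i^{p^{n−1−i}−1}·da_i ∈ FilΩ_{r−1}, then a ∈ (F(W_{n+1}(L)) ∩ Fil^p_r Wₙ(L)) + Fil^p_{r−1} Wₙ(L) + p̲(Fil^p_r W_{n−1}(L)), where F(W_{n+1}(L)) = {x ∈ Wₙ(L) : every component of x is a p-th power in L}. -/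
noncomputable section

open scoped Classical

/-- A discretely valued field: a field `L` together with a normalized additive valuation
`v : L → ℤ ∪ {∞}` and a uniformizer `z` (so `v z = 1`).  The valuation ring is
`O = {a : L | 0 ≤ v a}`, with maximal ideal `𝔪 = {a : L | 1 ≤ v a}`. -/
structure DVField (L : Type) [Field L] : Type where
  v : L → WithTop ℤ
  z : L
  v_top : ∀ a : L, v a = ⊤ ↔ a = 0
  v_mul : ∀ a b : L, v (a * b) = v a + v b
  v_add : ∀ a b : L, min (v a) (v b) ≤ v (a + b)
  v_z : v z = 1

namespace DVField

variable {L : Type} [Field L]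

/-- `Wₙ(O) ⊆ Wₙ(L)`: the truncated Witt vectors all of whose components are integral. -/
def WO (D : DVField L) (p n : ℕ) : Set (TruncatedWittVector p n L) :=
  {x | ∀ i : Fin n, 0 ≤ D.v (x.coeff i)}

/-- The Brylinski–Kato filtration
`fil^log_r Wₙ(L) = {(a₀, …, a_{n-1}) | p^{n-1-i} · v(aᵢ) ≥ -r for all i}`. -/
def filLog (D : DVField L) (p r n : ℕ) : Set (TruncatedWittVector p n L) :=
  {x | ∀ i : Fin n, (↑(-(r : ℤ)) : WithTop ℤ) ≤ p ^ (n - 1 - (i : ℕ)) • D.v (x.coeff i)}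

end DVField

/-- The Verschiebung `V : Wₙ(L) → W_{n+1}(L)`, shifting components. -/
def wV {p : ℕ} {L : Type} [Field L] {n : ℕ} (x : TruncatedWittVector p n L) :
    TruncatedWittVector p (n + 1) L :=
  TruncatedWittVector.mk p fun i =>
    if h : (i : ℕ) = 0 then 0 else x.coeff ⟨(i : ℕ) - 1, by have := i.isLt; omega⟩

/-- The iterated Verschiebung `V^{n-m} : W_m(L) → Wₙ(L)` (for `m ≤ n`), given by shifting
components by `n - m`. -/
def wVit {p : ℕ} {L : Type} [Field L] {m n : ℕ} (x : TruncatedWittVector p m L) :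
    TruncatedWittVector p n L :=
  TruncatedWittVector.mk p fun i =>
    if h : n - m ≤ (i : ℕ) ∧ (i : ℕ) - (n - m) < m then x.coeff ⟨(i : ℕ) - (n - m), h.2⟩ else 0

/-- The restriction `R : W_{n+1}(L) → Wₙ(L)`, dropping the last component. -/
def wR {p : ℕ} {L : Type} [Field L] {n : ℕ} (x : TruncatedWittVector p (n + 1) L) :
    TruncatedWittVector p n L :=
  TruncatedWittVector.mk p fun i => x.coeff i.castSucc

/-- The iterated restriction `R^{m-n} : W_m(L) → Wₙ(L)` (for `n ≤ m`), keeping the first `n`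
components. -/
def wRes {p : ℕ} {L : Type} [Field L] {m n : ℕ} (x : TruncatedWittVector p m L) :
    TruncatedWittVector p n L :=
  TruncatedWittVector.mk p fun i => if h : (i : ℕ) < m then x.coeff ⟨(i : ℕ), h⟩ else 0

/-- The Frobenius `F : W_{n+1}(L) → Wₙ(L)` in characteristic `p`:
componentwise `p`-th power followed by restriction. -/
def wF {p : ℕ} {L : Type} [Field L] {n : ℕ} (x : TruncatedWittVector p (n + 1) L) :
    TruncatedWittVector p n L :=
  TruncatedWittVector.mk p fun i => x.coeff i.castSucc ^ p

/-- The Teichmüller lift `[a] = (a, 0, …, 0)`. -/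
def wT (p : ℕ) {L : Type} [Field L] (n : ℕ) (a : L) : TruncatedWittVector p n L :=
  TruncatedWittVector.mk p fun i => if (i : ℕ) = 0 then a else 0

/-- The map `p̲ : Wₙ(L) → W_{n+1}(L)`: lift to length `n+1` (by appending a zero component)
and multiply by `p`. -/
def wP {p : ℕ} [Fact p.Prime] {L : Type} [Field L] {n : ℕ} (x : TruncatedWittVector p n L) :
    TruncatedWittVector p (n + 1) L :=
  p • (wRes x : TruncatedWittVector p (n + 1) L)

namespace DVField

variable {L : Type} [Field L]

/-- The Kato–Matsuda filtration
`fil_r Wₙ(L) = fil^log_{r-1} Wₙ(L) + V^{n-m}(fil^log_r W_m(L))` where `m = min(v_p(r), n)`,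
and `fil_0 Wₙ(L) = Wₙ(O)`. -/
def filKM (D : DVField L) (p : ℕ) [Fact p.Prime] (r n : ℕ) :
    Set (TruncatedWittVector p n L) :=
  if r = 0 then D.WO p n
  else {x | ∃ a ∈ D.filLog p (r - 1) n,
    ∃ b ∈ D.filLog p r (min (padicValNat p r) n), x = a + wVit b}

/-- The `p`-saturation `Fil^p_r Wₙ(L) = Σ_{s=0}^{n-1} p^s · fil_{r·p^s} Wₙ(L)`. -/
def FilP (D : DVField L) (p : ℕ) [Fact p.Prime] (r n : ℕ) :
    Set (TruncatedWittVector p n L) :=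
  {x | ∃ f : Fin n → TruncatedWittVector p n L,
      (∀ s : Fin n, f s ∈ D.filKM p (r * p ^ (s : ℕ)) n) ∧
      x = ∑ s : Fin n, p ^ (s : ℕ) • f s}

end DVField

namespace DVField

variable {L : Type} [Field L]

/-- The valuation ring `O` is henselian: every monic polynomial with integral coefficients
having an integral approximate root at which the derivative is a unit has an integral
actual root refining it. -/
def IsHenselian (D : DVField L) : Prop :=
  ∀ f : Polynomial L, f.Monic → (∀ i : ℕ, 0 ≤ D.v (f.coeff i)) →
    ∀ a₀ : L, 0 ≤ D.v a₀ → 1 ≤ D.v (f.eval a₀) →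
      D.v ((Polynomial.derivative f).eval a₀) = 0 →
        ∃ a : L, 0 ≤ D.v a ∧ f.eval a = 0 ∧ 1 ≤ D.v (a - a₀)

/-- `K` is a coefficient field for the valuation ring `O`: a subfield of `L` contained in `O`
mapping isomorphically onto the residue field `κ = O/𝔪` (surjectivity onto `κ` suffices, since
a subfield of `O` automatically injects into `κ`). -/
def IsCoeffField (D : DVField L) (K : Subfield L) : Prop :=
  (∀ a ∈ K, 0 ≤ D.v a) ∧ (∀ a : L, 0 ≤ D.v a → ∃ μ ∈ K, 1 ≤ D.v (a - μ))

end DVField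

namespace DVField

variable {L : Type} [Field L]

/-- `Ω¹_O ⊆ Ω¹_L`: the image of the Kähler differentials of the valuation ring `O` in
`Ω¹_L = Ω[L⁄k]`, i.e. the additive subgroup generated by the elements `a • d b` with
`a, b ∈ O` (i.e. `v a ≥ 0` and `v b ≥ 0`). -/
def OmegaO (D : DVField L) (k : Type) [CommRing k] [Algebra k L] : AddSubgroup (Ω[L⁄k]) :=
  AddSubgroup.closure
    {ω | ∃ a b : L, 0 ≤ D.v a ∧ 0 ≤ D.v b ∧ ω = a • (KaehlerDifferential.D k L) b}

/-- `Ω¹_O(log) = Ω¹_O + O · dlog z ⊆ Ω¹_L`, where `dlog z = z⁻¹ • d z`. -/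
def OmegaOLog (D : DVField L) (k : Type) [CommRing k] [Algebra k L] : AddSubgroup (Ω[L⁄k]) :=
  AddSubgroup.closure
    ({ω | ∃ a b : L, 0 ≤ D.v a ∧ 0 ≤ D.v b ∧ ω = a • (KaehlerDifferential.D k L) b} ∪
      {ω | ∃ a : L, 0 ≤ D.v a ∧ ω = a • (D.z⁻¹ • (KaehlerDifferential.D k L) D.z)})

end DVField

/-- The map `F^{n-1}d : Wₙ(L) → Ω¹_L`, `(a₀, …, a_{n-1}) ↦ Σᵢ aᵢ^{p^{n-1-i}-1} • daᵢ`
(the component formula for the composite of the de Rham–Witt differential with the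
`(n-1)`-fold Frobenius). -/
def wFd (p : ℕ) (k : Type) [CommRing k] {L : Type} [Field L] [Algebra k L] {n : ℕ}
    (x : TruncatedWittVector p n L) : Ω[L⁄k] :=
  ∑ i : Fin n, x.coeff i ^ (p ^ (n - 1 - (i : ℕ)) - 1) • (KaehlerDifferential.D k L) (x.coeff i)

namespace DVField

variable {L : Type} [Field L]

/-- The explicit description of `Fil^p_s Ω¹_L = Fil^p_s W₁Ω¹_L`:
`𝔪^{-(s-1)} · Ω¹_O(log)` if `p ∤ s`, and `𝔪^{-s} · Ω¹_O` if `p ∣ s`. -/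
def FilOmega (D : DVField L) (k : Type) [CommRing k] [Algebra k L] (p s : ℕ) :
    Set (Ω[L⁄k]) :=
  if p ∣ s then {ω | ∃ η ∈ D.OmegaO k, ω = (D.z ^ s)⁻¹ • η}
  else {ω | ∃ η ∈ D.OmegaOLog k, ω = (D.z ^ (s - 1))⁻¹ • η}

/-- The explicit description of `Fil^p_s W₁(L)`:
`𝔪^{-(s-1)}` if `p ∤ s`, and `𝔪^{-s}` if `p ∣ s`. -/
def filWOne (D : DVField L) (p s : ℕ) : Set L :=
  if p ∣ s then {a : L | (↑(-(s : ℤ)) : WithTop ℤ) ≤ D.v a}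
  else {a : L | (↑(-((s : ℤ) - 1)) : WithTop ℤ) ≤ D.v a}

end DVField


namespace WittAux
open WittVector MvPolynomial

theorem teich_mul_inv (p : ℕ) [Fact p.Prime] {R : Type} [CommRing R] [Invertible (p : R)]
    (a : R) (x : WittVector p R) :
    teichmuller p a * x = WittVector.mk p (fun i => a ^ p ^ i * x.coeff i) := by
  apply (ghostMap.bijective_of_invertible p R).1
  funext n
  rw [ghostMap_apply, ghostMap_apply, map_mul, ghostComponent_teichmuller, ghostComponent_apply,
    ghostComponent_apply, aeval_wittPolynomial, aeval_wittPolynomial, Finset.mul_sum]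
  refine Finset.sum_congr rfl fun i hi => ?_
  have : i ≤ n := by simpa [Nat.lt_succ_iff] using hi
  rw [coeff_mk, mul_pow, ← pow_mul, ← pow_add, Nat.add_sub_cancel' this]
  ring

theorem teich_mul (p : ℕ) [Fact p.Prime] {R : Type} [CommRing R]
    (a : R) (x : WittVector p R) (i : ℕ) :
    (teichmuller p a * x).coeff i = a ^ p ^ i * x.coeff i := by
  have key : ∀ (b : MvPolynomial (Option ℕ) ℤ) (y : WittVector p (MvPolynomial (Option ℕ) ℤ)),
      teichmuller p b * y = WittVector.mk p (fun i => b ^ p ^ i * y.coeff i) := by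
    intro b y
    refine map_injective (MvPolynomial.map (Int.castRingHom ℚ))
      (MvPolynomial.map_injective _ Int.cast_injective) ?_
    rw [_root_.map_mul, map_teichmuller]
    have : Invertible ((p : ℕ) : MvPolynomial (Option ℕ) ℚ) := by
      have : Invertible ((p : ℚ)) := invertibleOfNonzero (by exact_mod_cast (Fact.out : p.Prime).ne_zero)
      have h := Invertible.map (MvPolynomial.C (R := ℚ) (σ := Option ℕ)) (p : ℚ)
      rwa [map_natCast] at h
    rw [teich_mul_inv]
    ext n
    simp [WittVector.map_coeff]
  let f : MvPolynomial (Option ℕ) ℤ →+* R :=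
    (MvPolynomial.aeval (fun o : Option ℕ => o.elim a x.coeff)).toRingHom
  have hx : WittVector.map f (WittVector.mk p fun i => X (some i)) = x := by
    ext n; simp [WittVector.map_coeff, f]
  have ha : f (X none) = a := by simp [f]
  have h := congrArg (fun w => (WittVector.map f w).coeff i)
    (key (X none) (WittVector.mk p fun i => X (some i)))
  simp only [_root_.map_mul, map_teichmuller, hx, ha] at h
  rw [h, WittVector.map_coeff, coeff_mk, coeff_mk]
  simp [f]

/-- the differential form attached to a Witt vector -/
def fd (p n : ℕ) {R : Type} [CommRing R] (x : ℕ → R) : Ω[R⁄ℤ] :=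
  ∑ i ∈ Finset.range n, x i ^ (p ^ (n - 1 - i) - 1) • KaehlerDifferential.D ℤ R (x i)

theorem D_ghost (p n : ℕ) [Fact p.Prime] {R : Type} [CommRing R] (x : WittVector p R) :
    KaehlerDifferential.D ℤ R (ghostComponent n x) = (p ^ n : ℕ) • fd p (n+1) x.coeff := by
  rw [ghostComponent_apply, aeval_wittPolynomial, map_sum, fd, Finset.smul_sum]
  refine Finset.sum_congr rfl fun i hi => ?_
  have : i ≤ n := by simpa [Nat.lt_succ_iff] using hi
  rw [Derivation.leibniz, Derivation.leibniz_pow, Derivation.leibniz_pow]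
  rw [Derivation.map_natCast]
  simp only [smul_zero, add_zero, Nat.add_sub_cancel]
  rw [← Nat.cast_smul_eq_nsmul R, ← Nat.cast_smul_eq_nsmul R, smul_smul, smul_smul, smul_smul]
  congr 1
  push_cast
  rw [← pow_add, Nat.add_sub_cancel' this]

theorem kd_torsion (σ : Type) (inst : Algebra ℤ (MvPolynomial σ ℤ)) (k : ℕ) (hk : k ≠ 0)
    (a b : @KaehlerDifferential ℤ (MvPolynomial σ ℤ) _ _ inst) (h : k • a = k • b) : a = b := by
  obtain rfl : inst = AddMonoidAlgebra.algebra := Subsingleton.elim _ _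
  apply (KaehlerDifferential.mvPolynomialBasis ℤ σ).repr.injective
  ext1 j
  have h2 := congrArg (fun w => (KaehlerDifferential.mvPolynomialBasis ℤ σ).repr w j) h
  simp only [map_nsmul, Finsupp.smul_apply] at h2
  exact smul_right_injective _ hk h2

theorem fd_add_poly (p n : ℕ) [Fact p.Prime] {σ : Type}
    (x y : WittVector p (MvPolynomial σ ℤ)) :
    fd p (n+1) (x + y).coeff = fd p (n+1) x.coeff + fd p (n+1) y.coeff := by
  have h : (p ^ n : ℕ) • fd p (n+1) (x + y).coeff
      = (p ^ n : ℕ) • (fd p (n+1) x.coeff + fd p (n+1) y.coeff) := by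
    rw [smul_add, ← D_ghost, ← D_ghost, ← D_ghost, map_add, map_add]
  exact kd_torsion σ _ _ (pow_ne_zero _ (Fact.out : p.Prime).ne_zero) _ _ h

theorem fd_map (p n : ℕ) {R S : Type} [CommRing R] [CommRing S] (f : R →+* S) :
    ∃ φ : Ω[R⁄ℤ] →+ Ω[S⁄ℤ], ∀ x : ℕ → R, φ (fd p n x) = fd p n (fun i => f (x i)) := by
  let _ := f.toAlgebra
  refine ⟨(KaehlerDifferential.map ℤ ℤ R S).toAddMonoidHom, fun x => ?_⟩
  simp only [fd, LinearMap.toAddMonoidHom_coe, map_sum, map_smul, KaehlerDifferential.map_D]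
  refine Finset.sum_congr rfl fun i _ => ?_
  rw [algebra_compatible_smul S, map_pow]
  rfl

theorem fd_add (p n : ℕ) [Fact p.Prime] {R : Type} [CommRing R]
    (x y : WittVector p R) :
    fd p (n+1) (x + y).coeff = fd p (n+1) x.coeff + fd p (n+1) y.coeff := by
  let f : MvPolynomial (ℕ ⊕ ℕ) ℤ →+* R :=
    (MvPolynomial.aeval (Sum.elim x.coeff y.coeff)).toRingHom
  let x' : WittVector p (MvPolynomial (ℕ ⊕ ℕ) ℤ) := WittVector.mk p fun i => X (Sum.inl i)
  let y' : WittVector p (MvPolynomial (ℕ ⊕ ℕ) ℤ) := WittVector.mk p fun i => X (Sum.inr i)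
  have hx : WittVector.map f x' = x := by
    ext n; simp [WittVector.map_coeff, f, x']
  have hy : WittVector.map f y' = y := by
    ext n; simp [WittVector.map_coeff, f, y']
  obtain ⟨φ, hφ⟩ := fd_map p (n+1) f
  have h := congrArg φ (fd_add_poly p n x' y')
  rw [map_add, hφ, hφ, hφ] at h
  simp only [← WittVector.map_coeff] at h
  rw [_root_.map_add, hx, hy] at h
  exact h

end WittAux


namespace Cartier
open Polynomial

theorem exists_max {K : Type} [Field K] (p : ℕ) [Fact p.Prime] [CharP K p] (u : K)
    (hu : ∀ y : K, u ≠ y ^ p) :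
    ∃ M : Subfield K, (∀ y, y ^ p ∈ M) ∧ u ∉ M ∧ ∀ M' : Subfield K, M ≤ M' → u ∉ M' → M' ≤ M := by
  have h := zorn_le_nonempty₀ {M : Subfield K | (∀ y, y ^ p ∈ M) ∧ u ∉ M} ?_
    (frobenius K p).fieldRange ?_
  · obtain ⟨M, -, ⟨h1, h2⟩, h3⟩ := h
    exact ⟨M, h1, h2, fun M' hle hu' => h3 ⟨fun y => hle (h1 y), hu'⟩ hle⟩
  · intro c hc hch y hy
    refine ⟨sSup c, ⟨fun x => ?_, ?_⟩, fun z hz => le_sSup hz⟩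
    · exact (le_sSup hy : y ≤ sSup c) ((hc hy).1 x)
    · rw [Subfield.mem_sSup_of_directedOn ⟨y, hy⟩ hch.directedOn]
      rintro ⟨s, hs, hus⟩
      exact (hc hs).2 hus
  · refine ⟨fun y => ⟨y, rfl⟩, ?_⟩
    rintro ⟨y, hy⟩
    exact hu y hy.symm

theorem irr {K : Type} [Field K] (p : ℕ) [Fact p.Prime] [CharP K p] (M : Subfield K)
    (x : K) (hx : x ∉ M) (hM : x ^ p ∈ M) : Irreducible (X ^ p - C (⟨x ^ p, hM⟩ : M)) := by
  apply X_pow_sub_C_irreducible_of_prime Fact.out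
  intro b hb
  have : (b : K) ^ p = x ^ p := congrArg Subtype.val hb
  have := frobenius_inj K p this
  exact hx (this ▸ b.2)

theorem minp {K : Type} [Field K] (p : ℕ) [Fact p.Prime] [CharP K p] (M : Subfield K)
    (x : K) (hx : x ∉ M) (hM : x ^ p ∈ M) : minpoly M x = X ^ p - C (⟨x ^ p, hM⟩ : M) := by
  symm
  apply minpoly.eq_of_irreducible_of_monic (irr p M x hx hM)
  · simp [Algebra.algebraMap_eq_smul_one, Subfield.smul_def]
  · exact monic_X_pow_sub_C _ (Fact.out : p.Prime).ne_zero

theorem surj {K : Type} [Field K] (p : ℕ) [Fact p.Prime] [CharP K p] (M : Subfield K) (u : K)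
    (h1 : ∀ y, y ^ p ∈ M) (h2 : u ∉ M) (h3 : ∀ M' : Subfield K, M ≤ M' → u ∉ M' → M' ≤ M) :
    Function.Surjective (aeval u : M[X] →ₐ[M] K) := by
  have hint : ∀ x : K, IsIntegral M x := fun x =>
    ⟨X ^ p - C (⟨x ^ p, h1 x⟩ : M), monic_X_pow_sub_C _ (Fact.out : p.Prime).ne_zero, by
      simp [Algebra.algebraMap_eq_smul_one, Subfield.smul_def]⟩
  have hfr : ∀ x : K, x ∉ M → Module.finrank M (IntermediateField.adjoin M {x}) = p := by
    intro x hx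
    rw [IntermediateField.adjoin.finrank (hint x), minp p M x hx (h1 x), natDegree_X_pow_sub_C]
  have key : ∀ x : K, x ∈ IntermediateField.adjoin M {u} := by
    intro x
    by_cases hx : x ∈ M
    · exact (IntermediateField.adjoin M {u}).algebraMap_mem ⟨x, hx⟩
    have hux : u ∈ IntermediateField.adjoin M {x} := by
      by_contra hcon
      refine hx (h3 (IntermediateField.adjoin M {x}).toSubfield ?_ hcon ?_)
      · intro m hm
        exact (IntermediateField.adjoin M {x}).algebraMap_mem ⟨m, hm⟩
      · exact IntermediateField.mem_adjoin_simple_self M x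
    have hle : IntermediateField.adjoin M {u} ≤ IntermediateField.adjoin M {x} := by
      rw [IntermediateField.adjoin_simple_le_iff]; exact hux
    have : FiniteDimensional M (IntermediateField.adjoin M {x}) :=
      IntermediateField.adjoin.finiteDimensional (hint x)
    have := IntermediateField.eq_of_le_of_finrank_eq hle (by rw [hfr u h2, hfr x hx])
    rw [this]
    exact IntermediateField.mem_adjoin_simple_self M x
  intro x
  have hx := key x
  rw [← IntermediateField.mem_toSubalgebra,
    IntermediateField.adjoin_simple_toSubalgebra_of_isAlgebraic (hint u).isAlgebraic,
    Algebra.adjoin_singleton_eq_range_aeval] at hx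
  exact hx

theorem exists_deriv {K : Type} [Field K] (p : ℕ) [Fact p.Prime] [CharP K p] (u : K)
    (hu : ∀ y : K, u ≠ y ^ p) :
    ∃ (M : Subfield K) (δ : Derivation ℤ K K), Function.Surjective (aeval u : M[X] →ₐ[M] K) ∧
      (∀ P : M[X], δ (aeval u P) = aeval u (derivative P)) := by
  obtain ⟨M, h1, h2, h3⟩ := exists_max p u hu
  have hs := surj p M u h1 h2 h3
  have hd : ∀ x : M[X], (aeval u : M[X] →ₐ[M] K) x = 0 →
      (aeval u : M[X] →ₐ[M] K) ((Polynomial.derivative' : Derivation M M[X] M[X]) x) = 0 := by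
    intro x hx
    obtain ⟨q, rfl⟩ := minpoly.dvd M u hx
    rw [minp p M u h2 (h1 u)]
    have : (aeval u : M[X] →ₐ[M] K) (X ^ p - C (⟨u ^ p, h1 u⟩ : M)) = 0 := by
      simp [Algebra.algebraMap_eq_smul_one, Subfield.smul_def]
    rw [Derivation.leibniz, map_add, smul_eq_mul, smul_eq_mul, _root_.map_mul, _root_.map_mul, this]
    simp [derivative'_apply, derivative_X_pow]
  refine ⟨M, (Derivation.liftOfSurjective (f := (aeval u : M[X] →ₐ[M] K)) hs hd).restrictScalars ℤ,
    hs, fun P => ?_⟩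
  exact Derivation.liftOfSurjective_apply hs hd P

section
variable {K : Type} [Field K] (p : ℕ) [Fact p.Prime] [CharP K p] (u : K)
  (M : Subfield K) (δ : Derivation ℤ K K) (hs : Function.Surjective (aeval u : M[X] →ₐ[M] K))
  (hδ : ∀ P : M[X], δ (aeval u P) = aeval u (derivative P))

theorem iter (hδ : ∀ P : M[X], δ (aeval u P) = aeval u (derivative P)) (k : ℕ) (P : M[X]) :
    δ^[k] (aeval u P) = aeval u (derivative^[k] P) := by
  induction k generalizing P with
  | zero => rfl
  | succ k ih => rw [Function.iterate_succ_apply, Function.iterate_succ_apply, hδ, ih]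

theorem iter_p (hs : Function.Surjective (aeval u : M[X] →ₐ[M] K))
    (hδ : ∀ P : M[X], δ (aeval u P) = aeval u (derivative P)) (x : K) : δ^[p] x = 0 := by
  obtain ⟨P, rfl⟩ := hs x
  rw [iter u M δ hδ, ← Polynomial.factorial_smul_hasseDeriv]
  have : ((p.factorial : ℕ) : K) = 0 := by
    rw [CharP.cast_eq_zero_iff K p]
    exact (Fact.out : p.Prime).dvd_factorial.2 le_rfl
  rw [LinearMap.smul_apply, map_nsmul, nsmul_eq_mul, this, zero_mul]

theorem iter_X (hδ : ∀ P : M[X], δ (aeval u P) = aeval u (derivative P)) :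
    δ^[p-1] (u ^ (p-1)) = -1 := by
  have h := iter u M δ hδ (p-1) (X ^ (p-1))
  rw [map_pow, aeval_X] at h
  rw [h, iterate_derivative_X_pow_eq_natCast_mul, Nat.descFactorial_self]
  simp only [Nat.sub_self, pow_zero, mul_one, map_natCast]
  have := congrArg (ZMod.castHom (dvd_refl p) K) (ZMod.wilsons_lemma p)
  rwa [map_natCast, map_neg, map_one] at this

theorem der_pow (y : K) : δ (y ^ p) = 0 := by
  rw [Derivation.leibniz_pow, ← Nat.cast_smul_eq_nsmul K]; simp

theorem iter_mul (k : ℕ) (y w : K) : δ^[k] (y ^ p * w) = y ^ p * δ^[k] w := by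
  induction k generalizing w with
  | zero => rfl
  | succ k ih =>
    rw [Function.iterate_succ_apply, Function.iterate_succ_apply, Derivation.leibniz, der_pow p,
      smul_zero, add_zero, smul_eq_mul, ih]

theorem iter_add (k : ℕ) (x w : K) : δ^[k] (x + w) = δ^[k] x + δ^[k] w := by
  induction k generalizing x w with
  | zero => rfl
  | succ k ih => simp only [Function.iterate_succ_apply, map_add, ih]

theorem witt_leib (g h : K) : ∃ s : K,
    g ^ (p-1) * δ g + h ^ (p-1) * δ h = (g+h)^(p-1) * δ (g+h) + δ s := by
  have key := WittAux.fd_add p 1 (WittVector.teichmuller p g) (WittVector.teichmuller p h)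
  have key2 := congrArg δ.liftKaehlerDifferential key
  simp [WittAux.fd, Finset.sum_range_succ, WittVector.add_coeff_zero] at key2
  refine ⟨(WittVector.teichmuller p g + WittVector.teichmuller p h).coeff 1, ?_⟩
  rw [← key2, map_add]; ring

theorem formula (hs : Function.Surjective (aeval u : M[X] →ₐ[M] K))
    (hδ : ∀ P : M[X], δ (aeval u P) = aeval u (derivative P)) (g : K) :
    δ^[p-1] (g ^ (p-1) * δ g) = - (δ g) ^ p := by
  have hp := (Fact.out : p.Prime)
  obtain ⟨P, rfl⟩ := hs g
  induction P using Polynomial.induction_on' with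
  | add P Q hP hQ =>
    obtain ⟨s, hs'⟩ := witt_leib p δ (aeval u P) (aeval u Q)
    have := congrArg δ^[p-1] hs'
    rw [iter_add, iter_add, hP, hQ, ← Function.iterate_succ_apply, Nat.succ_eq_add_one,
      Nat.sub_add_cancel hp.one_le, iter_p p u M δ hs hδ, add_zero] at this
    rw [map_add, ← this, map_add, add_pow_char]; ring
  | monomial j c =>
    rw [hδ, derivative_monomial, aeval_monomial, aeval_monomial]
    rcases j with _ | j
    · simp [hp.ne_zero]
    · have hj : ((j+1 : ℕ) : K) = ((j+1 : ℕ) : K) ^ p := by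
        have := congrArg (ZMod.castHom (dvd_refl p) K) (ZMod.pow_card ((j+1 : ℕ) : ZMod p))
        rw [map_pow, map_natCast] at this
        exact this.symm
      set cc : K := algebraMap M K c with hcc
      have e1 : (cc * u ^ (j+1)) ^ (p-1) * (algebraMap M K (c * ((j+1 : ℕ) : M)) * u ^ (j + 1 - 1))
          = (cc * ((j+1 : ℕ) : K) * u ^ j) ^ p * u ^ (p-1) := by
        obtain ⟨q, hq⟩ : ∃ q, p = q + 1 := ⟨p - 1, by have := hp.one_le; omega⟩
        rw [_root_.map_mul, map_natCast, ← hcc, mul_pow, mul_pow, mul_pow, ← hj, hq]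
        simp only [Nat.add_sub_cancel]
        ring
      rw [e1, iter_mul, iter_X p u M δ hδ, _root_.map_mul, map_natCast, ← hcc]
      simp

theorem cartier (hs : Function.Surjective (aeval u : M[X] →ₐ[M] K))
    (hδ : ∀ P : M[X], δ (aeval u P) = aeval u (derivative P)) (N : ℕ) (w : ℕ → K)
    (h : ∑ i ∈ Finset.range (N+1), w i ^ (p ^ (N - i) - 1) * δ (w i) = 0) :
    ∀ i ≤ N, δ (w i) = 0 := by
  have hp := (Fact.out : p.Prime)
  induction N with
  | zero =>
    intro i hi
    obtain rfl : i = 0 := by omega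
    simpa using h
  | succ N ih =>
    have hsum : ∀ (s : Finset ℕ) (f : ℕ → K), δ^[p-1] (∑ i ∈ s, f i) = ∑ i ∈ s, δ^[p-1] (f i) := by
      intro s f
      exact map_sum (AddMonoidHom.mk' (δ^[p-1]) (iter_add δ (p-1))) f s
    have h0 : δ^[p-1] 0 = 0 := (AddMonoidHom.mk' (δ^[p-1]) (iter_add δ (p-1))).map_zero
    have h' := congrArg δ^[p-1] h
    rw [h0, Finset.sum_range_succ, iter_add, hsum] at h'
    simp only [Nat.sub_self, pow_zero, one_mul] at h'
    rw [← Function.iterate_succ_apply, Nat.succ_eq_add_one,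
      Nat.sub_add_cancel hp.one_le, iter_p p u M δ hs hδ, add_zero] at h'
    have h3 : ∀ i ∈ Finset.range (N+1), δ^[p-1] (w i ^ (p ^ (N + 1 - i) - 1) * δ (w i)) =
        - (w i ^ (p ^ (N - i) - 1) * δ (w i)) ^ p := by
      intro i hi
      have hi' : i ≤ N := by simpa [Nat.lt_succ_iff] using hi
      have e : p ^ (N + 1 - i) - 1 = (p ^ (N - i) - 1) * p + (p - 1) := by
        rw [show N + 1 - i = N - i + 1 by omega, pow_succ]
        have h1 : 1 ≤ p ^ (N - i) := Nat.one_le_pow _ _ hp.pos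
        obtain ⟨a, ha⟩ : ∃ a, p ^ (N - i) = a + 1 := ⟨p ^ (N-i) - 1, by omega⟩
        rw [ha]
        have := hp.one_le
        simp only [Nat.add_sub_cancel, add_mul, one_mul]
        omega
      rw [e, pow_add, pow_mul, mul_assoc, iter_mul, formula p u M δ hs hδ, mul_pow]
      ring
    rw [Finset.sum_congr rfl h3, Finset.sum_neg_distrib, neg_eq_zero, ← sum_pow_char] at h'
    have h4 := pow_eq_zero_iff hp.ne_zero |>.1 h'
    have h5 := ih h4
    intro i hi
    rcases Nat.lt_or_ge i (N+1) with hlt | hge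
    · exact h5 i (by omega)
    · obtain rfl : i = N+1 := by omega
      rw [Finset.sum_range_succ, Finset.sum_eq_zero] at h
      · simpa using h
      · intro j hj
        rw [h5 j (by simpa [Nat.lt_succ_iff] using hj), mul_zero]
end

theorem main {K : Type} [Field K] (p : ℕ) [Fact p.Prime] [CharP K p] (N : ℕ) (w : ℕ → K)
    (h : ∀ δ : Derivation ℤ K K,
      ∑ i ∈ Finset.range (N+1), w i ^ (p ^ (N - i) - 1) * δ (w i) = 0) :
    ∀ i ≤ N, ∃ y, w i = y ^ p := by
  intro i hi
  by_contra hcon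
  push Not at hcon
  obtain ⟨M, δ, hs, hδ⟩ := exists_deriv p (w i) hcon
  have h1 := cartier p (w i) M δ hs hδ N w (h δ) i hi
  have h2 := hδ X
  simp [h1] at h2

end Cartier


namespace DVField
variable {L : Type} [Field L] (D : DVField L)

def ge (k : ℤ) (a : L) : Prop := (k : WithTop ℤ) ≤ D.v a

theorem v_zero : D.v 0 = ⊤ := (D.v_top 0).2 rfl

theorem exists_v {a : L} (ha : a ≠ 0) : ∃ k : ℤ, D.v a = k := by
  have : D.v a ≠ ⊤ := fun h => ha ((D.v_top a).1 h)
  obtain ⟨k, hk⟩ := WithTop.ne_top_iff_exists.1 this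
  exact ⟨k, hk.symm⟩

theorem v_one : D.v 1 = 0 := by
  obtain ⟨k, hk⟩ := D.exists_v (one_ne_zero (α := L))
  have h := D.v_mul 1 1
  rw [mul_one, hk] at h
  rw [hk]
  have h' : k = k + k := by exact_mod_cast h
  have : k = 0 := by omega
  rw [this]; rfl

theorem v_neg_one : D.v (-1) = 0 := by
  obtain ⟨k, hk⟩ := D.exists_v (neg_ne_zero.2 (one_ne_zero (α := L)))
  have h := D.v_mul (-1) (-1)
  rw [neg_mul_neg, mul_one, hk, v_one] at h
  rw [hk]
  have h' : 0 = k + k := by exact_mod_cast h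
  have : k = 0 := by omega
  rw [this]; rfl

theorem v_pow (a : L) (n : ℕ) : D.v (a ^ n) = n • D.v a := by
  induction n with
  | zero => simp [v_one]
  | succ n ih => rw [pow_succ, D.v_mul, ih, succ_nsmul]

theorem z_ne : D.z ≠ 0 := by
  intro h
  have := D.v_z
  rw [h, v_zero] at this
  exact absurd this (by decide)

theorem ge_zero (k : ℤ) : D.ge k 0 := by simp [ge, v_zero]

theorem ge_mono {j k : ℤ} {a : L} (h : j ≤ k) (ha : D.ge k a) : D.ge j a :=
  le_trans (by exact_mod_cast h) ha

theorem ge_add {k : ℤ} {a b : L} (ha : D.ge k a) (hb : D.ge k b) : D.ge k (a + b) :=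
  le_trans (le_min ha hb) (D.v_add a b)

theorem ge_mul {j k : ℤ} {a b : L} (ha : D.ge j a) (hb : D.ge k b) : D.ge (j + k) (a * b) := by
  unfold ge
  rw [D.v_mul, WithTop.coe_add]
  exact add_le_add ha hb

theorem ge_one : D.ge 0 1 := by unfold ge; rw [v_one]; rfl

theorem ge_neg {k : ℤ} {a : L} (ha : D.ge k a) : D.ge k (-a) := by
  have h : D.ge 0 (-1) := by unfold ge; rw [v_neg_one]; rfl
  have := D.ge_mul h ha
  simpa using this

theorem ge_sub {k : ℤ} {a b : L} (ha : D.ge k a) (hb : D.ge k b) : D.ge k (a - b) := by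
  rw [sub_eq_add_neg]; exact D.ge_add ha (D.ge_neg hb)

theorem v_eq_ge {k : ℤ} {a : L} (h : D.v a = k) (j : ℤ) : D.ge j a ↔ j ≤ k := by
  unfold ge; rw [h]; exact WithTop.coe_le_coe

theorem v_pow_eq {k : ℤ} {a : L} (h : D.v a = k) (n : ℕ) : D.v (a ^ n) = ((n * k : ℤ) : WithTop ℤ) := by
  rw [v_pow, h, ← WithTop.coe_nsmul, nsmul_eq_mul]

theorem ge_pow_iff {k : ℤ} {a : L} {n : ℕ} (hn : 0 < n) : D.ge (n * k) (a ^ n) ↔ D.ge k a := by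
  by_cases ha : a = 0
  · subst ha; rw [zero_pow hn.ne']; simp [ge_zero]
  obtain ⟨l, hl⟩ := D.exists_v ha
  rw [D.v_eq_ge hl, D.v_eq_ge (D.v_pow_eq hl n)]
  constructor
  · intro h; exact le_of_mul_le_mul_left h (by exact_mod_cast hn)
  · intro h; exact mul_le_mul_of_nonneg_left h (by positivity)

theorem v_inv {a : L} {k : ℤ} (h : D.v a = k) : D.v a⁻¹ = ((-k : ℤ) : WithTop ℤ) := by
  have ha : a ≠ 0 := by rintro rfl; rw [v_zero] at h; exact absurd h (by simp)
  obtain ⟨l, hl⟩ := D.exists_v (inv_ne_zero ha)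
  have h2 := D.v_mul a a⁻¹
  rw [mul_inv_cancel₀ ha, v_one, h, hl] at h2
  have : (0:ℤ) = k + l := by exact_mod_cast h2
  rw [hl]; congr 1; omega

theorem v_zpow (k : ℤ) : D.v (D.z ^ k) = k := by
  have hn : ∀ n : ℕ, D.v (D.z ^ n) = ((n:ℤ) : WithTop ℤ) := by
    intro n
    have := D.v_pow_eq (k := 1) D.v_z n
    simpa using this
  obtain ⟨n, rfl | rfl⟩ := k.eq_nat_or_neg
  · rw [zpow_natCast]; exact hn n
  · rw [zpow_neg, zpow_natCast]; exact D.v_inv (hn n)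

theorem ge_z (k : ℤ) : D.ge k (D.z ^ k) := by unfold ge; rw [v_zpow]

theorem ge_shift (j k : ℤ) (a : L) : D.ge (j + k) (D.z ^ j * a) ↔ D.ge k a := by
  constructor
  · intro h
    have := D.ge_mul (D.ge_z (-j)) h
    rw [← mul_assoc, ← zpow_add₀ D.z_ne] at this
    simpa using this
  · intro h; exact D.ge_mul (D.ge_z j) h

theorem log_iff (r : ℕ) (q : ℕ) (a : L) :
    ((-(r : ℤ) : ℤ) : WithTop ℤ) ≤ q • D.v a ↔ D.ge (-(r:ℤ)) (a ^ q) := by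
  unfold ge; rw [v_pow]

/-- valuation ring -/
def O : ValuationSubring L where
  carrier := {a | D.ge 0 a}
  mul_mem' := fun {a b} ha hb => by simpa using D.ge_mul ha hb
  one_mem' := D.ge_one
  add_mem' := fun {a b} ha hb => D.ge_add ha hb
  zero_mem' := D.ge_zero 0
  neg_mem' := fun {a} ha => D.ge_neg ha
  mem_or_inv_mem' := fun a => by
    by_cases ha : a = 0
    · left; subst ha; exact D.ge_zero 0
    obtain ⟨k, hk⟩ := D.exists_v ha
    rcases le_total 0 k with h | h
    · left; exact (D.v_eq_ge hk 0).2 h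
    · right; exact (D.v_eq_ge (D.v_inv hk) 0).2 (by omega)

theorem mem_O (a : L) : a ∈ D.O ↔ D.ge 0 a := Iff.rfl

/-- ideal -/
def I (k : ℕ) : Ideal D.O where
  carrier := {a | D.ge k (a : L)}
  add_mem' := fun {a b} ha hb => D.ge_add ha hb
  zero_mem' := D.ge_zero _
  smul_mem' := fun c x hx => by
    have := D.ge_mul c.2 hx
    simpa using this

open WittVector

theorem W1 (p : ℕ) [Fact p.Prime] (k : ℕ) (X Y : WittVector p L) (hX : ∀ i, D.ge 0 (X.coeff i))
    (hY : ∀ i, D.ge 0 (Y.coeff i)) (h : ∀ i, D.ge k (X.coeff i - Y.coeff i)) (i : ℕ) :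
    D.ge k ((X - Y).coeff i) := by
  let X' : WittVector p D.O := WittVector.mk p fun i => ⟨X.coeff i, hX i⟩
  let Y' : WittVector p D.O := WittVector.mk p fun i => ⟨Y.coeff i, hY i⟩
  have eX : WittVector.map D.O.subtype X' = X := by ext i; rfl
  have eY : WittVector.map D.O.subtype Y' = Y := by ext i; rfl
  have hq : WittVector.map (Ideal.Quotient.mk (D.I k)) X' = WittVector.map (Ideal.Quotient.mk (D.I k)) Y' := by
    ext i
    rw [WittVector.map_coeff, WittVector.map_coeff, Ideal.Quotient.eq]
    exact h i
  have hz : WittVector.map (Ideal.Quotient.mk (D.I k)) (X' - Y') = 0 := by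
    rw [_root_.map_sub, hq, sub_self]
  have hz' := congrArg (fun w => w.coeff i) hz
  simp only [WittVector.map_coeff, WittVector.zero_coeff] at hz'
  rw [Ideal.Quotient.eq_zero_iff_mem] at hz'
  rw [← eX, ← eY, ← _root_.map_sub, WittVector.map_coeff]
  exact hz'

theorem W2 (p : ℕ) [Fact p.Prime] [CharP L p] (r N k : ℕ) (X Y : WittVector p L)
    (hX : ∀ i, D.ge (-(r * p ^ i : ℕ)) (X.coeff i ^ p ^ N))
    (hY : ∀ i, D.ge (-(r * p ^ i : ℕ)) (Y.coeff i ^ p ^ N))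
    (h : ∀ i, D.ge (-(r * p ^ i : ℕ) + k) ((X.coeff i - Y.coeff i) ^ p ^ N)) (i : ℕ) :
    D.ge (-(r * p ^ i : ℕ) + k) ((X - Y).coeff i ^ p ^ N) := by
  let T : WittVector p L → WittVector p L := fun X =>
    teichmuller p (D.z ^ r) * (WittVector.frobenius^[N] X)
  have hT : ∀ X i, (T X).coeff i = D.z ^ ((r * p ^ i : ℕ) : ℤ) * X.coeff i ^ p ^ N := by
    intro X i
    simp only [T]
    rw [WittAux.teich_mul, WittVector.iterate_frobenius_coeff, zpow_natCast, pow_mul]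
  have hsub : T (X - Y) = T X - T Y := by
    simp only [T]; rw [iterate_map_sub, mul_sub]
  have key := D.W1 p k (T X) (T Y) ?_ ?_ ?_ i
  · rw [← hsub, hT] at key
    rw [← D.ge_shift ((r * p ^ i : ℕ) : ℤ)]
    convert key using 1; ring
  · intro i; rw [hT]
    have := (D.ge_shift ((r * p ^ i : ℕ) : ℤ) _ _).2 (hX i)
    convert this using 1; ring
  · intro i; rw [hT]
    have := (D.ge_shift ((r * p ^ i : ℕ) : ℤ) _ _).2 (hY i)
    convert this using 1; ring
  · intro i; rw [hT, hT, ← mul_sub, ← sub_pow_char_pow]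
    have := (D.ge_shift ((r * p ^ i : ℕ) : ℤ) _ _).2 (h i)
    convert this using 1; ring

set_option linter.unusedSectionVars false

section
variable {p : ℕ} [Fact p.Prime]

theorem tr_sub {n : ℕ} (x y : TruncatedWittVector p n L) (i : Fin n) :
    (x - y).coeff i = (x.out - y.out).coeff i := rfl

theorem tr_add {n : ℕ} (x y : TruncatedWittVector p n L) (i : Fin n) :
    (x + y).coeff i = (x.out + y.out).coeff i := rfl

theorem out_of_lt {n : ℕ} (x : TruncatedWittVector p n L) (i : ℕ) (h : i < n) :
    x.out.coeff i = x.coeff ⟨i, h⟩ := x.coeff_out ⟨i, h⟩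

theorem out_of_ge {n : ℕ} (x : TruncatedWittVector p n L) (i : ℕ) (h : n ≤ i) :
    x.out.coeff i = 0 := by
  simp [TruncatedWittVector.out, WittVector.coeff, not_lt.2 h]

theorem conv {r n : ℕ} (i : Fin (n+1)) (a : L) :
    D.ge (-(r:ℤ)) (a ^ p ^ (n - (i:ℕ))) ↔ D.ge (-(r * p ^ (i:ℕ) : ℕ)) (a ^ p ^ n) := by
  have hp : 0 < p ^ (i:ℕ) := pow_pos (Fact.out : p.Prime).pos _
  have hi : (i:ℕ) ≤ n := by omega
  rw [← D.ge_pow_iff hp, ← pow_mul, ← pow_add, Nat.sub_add_cancel hi]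
  congr! 1
  push_cast; ring

theorem mem_filLog {r n : ℕ} (x : TruncatedWittVector p (n+1) L) :
    x ∈ D.filLog p r (n+1) ↔ ∀ i : Fin (n+1), D.ge (-(r:ℤ)) (x.coeff i ^ p ^ (n - (i:ℕ))) := by
  unfold filLog
  simp only [Set.mem_ofPred_eq, Nat.add_sub_cancel, D.log_iff]

variable [CharP L p]

theorem log_out {r n : ℕ} {x : TruncatedWittVector p (n+1) L} (hx : x ∈ D.filLog p r (n+1)) (i : ℕ) :
    D.ge (-(r * p ^ i : ℕ)) (x.out.coeff i ^ p ^ n) := by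
  rcases lt_or_ge i (n+1) with h | h
  · rw [out_of_lt x i h]
    exact (D.conv ⟨i, h⟩ _).1 ((D.mem_filLog x).1 hx ⟨i, h⟩)
  · rw [out_of_ge x i h, zero_pow (pow_ne_zero _ (Fact.out : p.Prime).ne_zero)]
    exact D.ge_zero _

theorem log_sub {r n : ℕ} {x y : TruncatedWittVector p (n+1) L} (hx : x ∈ D.filLog p r (n+1))
    (hy : y ∈ D.filLog p r (n+1)) : x - y ∈ D.filLog p r (n+1) := by
  rw [mem_filLog]
  intro i
  rw [D.conv, tr_sub]
  have := D.W2 p r n 0 x.out y.out (D.log_out hx) (D.log_out hy) ?_ i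
  · simpa using this
  · intro i
    rw [sub_pow_char_pow]
    simpa using D.ge_sub (D.log_out hx i) (D.log_out hy i)

theorem log_zero {r n : ℕ} : (0 : TruncatedWittVector p (n+1) L) ∈ D.filLog p r (n+1) := by
  rw [mem_filLog]; intro i
  rw [TruncatedWittVector.coeff_zero, zero_pow (pow_ne_zero _ (Fact.out : p.Prime).ne_zero)]
  exact D.ge_zero _

theorem log_add {r n : ℕ} {x y : TruncatedWittVector p (n+1) L} (hx : x ∈ D.filLog p r (n+1))
    (hy : y ∈ D.filLog p r (n+1)) : x + y ∈ D.filLog p r (n+1) := by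
  have := D.log_sub hx (D.log_sub D.log_zero hy)
  simpa using this

/-- close approximations -/
theorem log_close {r n : ℕ} (hr : 1 ≤ r) {x y : TruncatedWittVector p (n+1) L}
    (hx : x ∈ D.filLog p r (n+1)) (hy : y ∈ D.filLog p r (n+1))
    (h : ∀ i : Fin (n+1), D.ge (-(r:ℤ) + p ^ (n - (i:ℕ)))
      ((x.coeff i - y.coeff i) ^ p ^ (n - (i:ℕ)))) :
    x - y ∈ D.filLog p (r-1) (n+1) := by
  have hp := (Fact.out : p.Prime)
  rw [mem_filLog]
  intro i
  rw [D.conv, tr_sub]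
  have := D.W2 p r n (p^n) x.out y.out (D.log_out hx) (D.log_out hy) ?_ i
  · refine D.ge_mono ?_ this
    have h1 : p ^ (i:ℕ) ≤ p ^ n := Nat.pow_le_pow_right hp.pos (by omega)
    obtain ⟨s, rfl⟩ : ∃ s, r = s + 1 := ⟨r - 1, by omega⟩
    zify at h1
    rw [Nat.add_sub_cancel]
    push_cast
    linarith
  · intro i
    rcases lt_or_ge i (n+1) with hi | hi
    · rw [out_of_lt x i hi, out_of_lt y i hi]
      have h3 := h ⟨i, hi⟩
      have hpi : 0 < p ^ (i:ℕ) := pow_pos hp.pos _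
      rw [← D.ge_pow_iff hpi, ← pow_mul, ← pow_add] at h3
      simp only at h3
      rw [Nat.sub_add_cancel (by omega)] at h3
      refine D.ge_mono (le_of_eq ?_) h3
      have : (p:ℤ) ^ n = p ^ i * p ^ (n - i) := by rw [← pow_add]; congr 1; omega
      push_cast
      rw [this]; ring
    · rw [out_of_ge x i hi, out_of_ge y i hi, sub_zero, zero_pow (pow_ne_zero _ hp.ne_zero)]
      exact D.ge_zero _

theorem add_disj {n : ℕ} (x y : TruncatedWittVector p n L)
    (h : ∀ i : Fin n, x.coeff i = 0 ∨ y.coeff i = 0) (i : Fin n) :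
    (x + y).coeff i = x.coeff i + y.coeff i := by
  rw [tr_add, WittVector.coeff_add_of_disjoint, TruncatedWittVector.coeff_out,
    TruncatedWittVector.coeff_out]
  intro j
  rcases lt_or_ge j n with hj | hj
  · rw [out_of_lt x j hj, out_of_lt y j hj]; exact h ⟨j, hj⟩
  · left; exact out_of_ge x j hj

end
end DVField


set_option linter.unusedSectionVars false

namespace DVField
variable {L : Type} [Field L] (D : DVField L) (K : Subfield L)

theorem ge_sum {ι : Type} (k : ℤ) (s : Finset ι) (f : ι → L) (h : ∀ i ∈ s, D.ge k (f i)) :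
    D.ge k (∑ i ∈ s, f i) := by
  induction s using Finset.induction_on with
  | empty => exact D.ge_zero k
  | insert a s ha ih =>
    rw [Finset.sum_insert ha]
    exact D.ge_add (h a (by simp)) (ih fun i hi => h i (by simp [hi]))

def approx (f : PowerSeries K) (a : L) : Prop :=
  ∀ N : ℕ, D.ge N (a - ∑ k ∈ Finset.range N, ((PowerSeries.coeff k f : K) : L) * D.z ^ k)

variable {K} (hK : D.IsCoeffField K)

theorem approx_exists (hK : D.IsCoeffField K) (a : L) (ha : D.ge 0 a) : ∃ f : PowerSeries K, D.approx K f a := by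
  have h1 : ∀ a : L, ∃ μ : K, D.ge 0 a → D.ge 1 (a - μ) := by
    intro a
    by_cases h : D.ge 0 a
    · obtain ⟨μ, hμ, h2⟩ := hK.2 a h
      exact ⟨⟨μ, hμ⟩, fun _ => h2⟩
    · exact ⟨0, fun h' => absurd h' h⟩
  choose ρ hρ using h1
  let s : ℕ → L := fun n => Nat.rec a (fun _ b => (b - ρ b) * D.z⁻¹) n
  have hs : ∀ n, s (n+1) = (s n - ρ (s n)) * D.z⁻¹ := fun n => rfl
  have hs0 : ∀ n, D.ge 0 (s n) := by
    intro n
    induction n with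
    | zero => exact ha
    | succ n ih =>
      rw [hs]
      have := D.ge_mul (hρ _ ih) (D.ge_z (-1))
      simpa using this
  refine ⟨PowerSeries.mk fun n => ρ (s n), fun N => ?_⟩
  have : a - ∑ k ∈ Finset.range N, ((PowerSeries.coeff k (PowerSeries.mk fun n => ρ (s n)) : K) : L) * D.z ^ k
      = D.z ^ (N:ℤ) * s N := by
    induction N with
    | zero => simp [s]
    | succ N ih =>
      rw [Finset.sum_range_succ, ← sub_sub, ih, hs, PowerSeries.coeff_mk]
      push_cast
      rw [zpow_add₀ D.z_ne, zpow_natCast, zpow_one]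
      field_simp [D.z_ne]
  rw [this]
  have := (D.ge_shift N 0 (s N)).2 (hs0 N)
  simpa using this

theorem K_ge (hK : D.IsCoeffField K) (u : K) : D.ge 0 (u : L) := hK.1 _ u.2

theorem K_zero (hK : D.IsCoeffField K) (u : K) (h : D.ge 1 (u : L)) : u = 0 := by
  by_contra hne
  have h2 := D.ge_mul h (D.K_ge hK u⁻¹)
  have : ((u : L)) * ((u⁻¹ : K) : L) = 1 := by
    rw [← Subfield.coe_mul, mul_inv_cancel₀ hne]; rfl
  rw [this] at h2
  have := (D.v_eq_ge (k := 0) D.v_one _).1 h2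
  omega

theorem approx_zero (hK : D.IsCoeffField K) (f : PowerSeries K) (h : D.approx K f 0) : f = 0 := by
  ext n
  induction n using Nat.strong_induction_on with
  | _ n ih =>
  have h1 := h (n+1)
  rw [Finset.sum_range_succ, Finset.sum_eq_zero] at h1
  · rw [zero_add, zero_sub] at h1
    have h2 := D.ge_neg h1
    rw [neg_neg, mul_comm, ← zpow_natCast] at h2
    have h3 := (D.ge_shift n 1 _).1 (by simpa using h2)
    rw [D.K_zero hK _ h3]; simp
  · intro k hk
    rw [ih k (by simpa using hk)]; simp

theorem approx_sub {f g : PowerSeries K} {a b : L} (hf : D.approx K f a) (hg : D.approx K g b) :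
    D.approx K (f - g) (a - b) := by
  intro N
  have := D.ge_sub (hf N) (hg N)
  convert this using 1
  simp only [map_sub, AddSubgroupClass.coe_sub, sub_mul, Finset.sum_sub_distrib]
  ring

theorem approx_add {f g : PowerSeries K} {a b : L} (hf : D.approx K f a) (hg : D.approx K g b) :
    D.approx K (f + g) (a + b) := by
  intro N
  have := D.ge_add (hf N) (hg N)
  convert this using 1
  simp only [map_add, Subfield.coe_add, add_mul, Finset.sum_add_distrib]
  ring

theorem approx_unique (hK : D.IsCoeffField K) {f g : PowerSeries K} {a : L} (hf : D.approx K f a)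
    (hg : D.approx K g a) : f = g := by
  have := D.approx_sub hf hg
  rw [sub_self] at this
  exact sub_eq_zero.1 (D.approx_zero hK _ this)

theorem ev_eq (N : ℕ) (f : PowerSeries K) :
    ∑ k ∈ Finset.range N, ((PowerSeries.coeff k f : K) : L) * D.z ^ k
      = (PowerSeries.trunc N f).eval₂ K.subtype D.z := by
  rw [PowerSeries.eval₂_trunc_eq_sum_range]; rfl

theorem ev_ge (hK : D.IsCoeffField K) (N : ℕ) (P : Polynomial K) (h : ∀ k < N, P.coeff k = 0) :
    D.ge N (P.eval₂ K.subtype D.z) := by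
  rw [Polynomial.eval₂_eq_sum, Polynomial.sum]
  refine D.ge_sum _ _ _ fun k _ => ?_
  rcases lt_or_ge k N with hk | hk
  · rw [h k hk]; simp [ge_zero]
  · have h2 := D.ge_mul (D.K_ge hK (P.coeff k)) (D.ge_z k)
    rw [zpow_natCast] at h2
    exact D.ge_mono (by omega) h2

theorem approx_mul (hK : D.IsCoeffField K) {f g : PowerSeries K} {a b : L} (ha : D.ge 0 a)
    (hf : D.approx K f a) (hg : D.approx K g b) :
    D.approx K (f * g) (a * b) := by
  intro N
  have h1 := hf N
  have h2 := hg N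
  rw [ev_eq] at h1 h2 ⊢
  have h3 := D.ev_ge hK N (PowerSeries.trunc N f * PowerSeries.trunc N g - PowerSeries.trunc N (f * g)) ?_
  · rw [Polynomial.eval₂_sub, Polynomial.eval₂_mul] at h3
    have hg0 : D.ge 0 ((PowerSeries.trunc N g).eval₂ K.subtype D.z) := by
      exact D.ev_ge hK 0 _ (by simp)
    have h4 := D.ge_mul ha h2
    have h5 := D.ge_mul h1 hg0
    rw [zero_add] at h4
    rw [add_zero] at h5
    have h6 := D.ge_add (D.ge_add h4 h5) h3
    convert h6 using 1
    ring
  · intro k hk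
    rw [Polynomial.coeff_sub, PowerSeries.coeff_trunc, if_pos hk,
      PowerSeries.coeff_mul_eq_coeff_trunc_mul_trunc f g hk, ← Polynomial.coe_mul,
      Polynomial.coeff_coe, sub_self]

theorem approx_C (hK : D.IsCoeffField K) (u : K) : D.approx K (PowerSeries.C u) u := by
  intro N
  rcases N with _ | N
  · simpa using D.K_ge hK u
  · rw [Finset.sum_range_succ', Finset.sum_eq_zero]
    · simp [ge_zero]
    · intro k _; simp [PowerSeries.coeff_C]

theorem approx_X : D.approx K PowerSeries.X D.z := by
  intro N
  rcases N with _ | _ | N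
  · simpa using D.ge_mono (by norm_num) (D.ge_z 1)
  · simpa using D.ge_z 1
  · rw [Finset.sum_range_succ', Finset.sum_range_succ', Finset.sum_eq_zero]
    · simp [ge_zero]
    · intro k _; simp [PowerSeries.coeff_X]

def toPS (hK : D.IsCoeffField K) : D.O →+* PowerSeries K :=
  RingHom.mk' ⟨⟨fun a => Classical.choose (D.approx_exists hK a a.2), by
      refine D.approx_unique hK (Classical.choose_spec (D.approx_exists hK _ (1 : D.O).2)) ?_
      exact (map_one (PowerSeries.C (R := K))) ▸ D.approx_C hK (1 : K)⟩, fun a b => by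
      refine D.approx_unique hK (Classical.choose_spec (D.approx_exists hK _ (a * b).2)) ?_
      exact D.approx_mul hK a.2 (Classical.choose_spec (D.approx_exists hK _ a.2))
        (Classical.choose_spec (D.approx_exists hK _ b.2))⟩ (fun a b => by
      refine D.approx_unique hK (Classical.choose_spec (D.approx_exists hK _ (a + b).2)) ?_
      exact D.approx_add (Classical.choose_spec (D.approx_exists hK _ a.2))
        (Classical.choose_spec (D.approx_exists hK _ b.2)))

theorem toPS_spec (hK : D.IsCoeffField K) (a : D.O) : D.approx K (D.toPS hK a) a :=
  Classical.choose_spec (D.approx_exists hK _ a.2)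

theorem toPS_inj (hK : D.IsCoeffField K) : Function.Injective (D.toPS hK) := by
  rw [injective_iff_map_eq_zero]
  intro a ha
  have h := D.toPS_spec hK a
  rw [ha] at h
  by_contra hne
  have : (a : L) ≠ 0 := fun h => hne (Subtype.ext h)
  obtain ⟨k, hk⟩ := D.exists_v this
  have h1 := h (k.toNat + 1)
  simp only [map_zero, ZeroMemClass.coe_zero, zero_mul, Finset.sum_const_zero, sub_zero] at h1
  have := (D.v_eq_ge hk _).1 h1
  push_cast at this
  omega

/-- order bound for Laurent series -/
def _root_.lge {F : Type} [Field F] (k : ℤ) (f : LaurentSeries F) : Prop := ∀ n < k, f.coeff n = 0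

theorem exists_iota (hK : D.IsCoeffField K) : ∃ ι : L →+* LaurentSeries K,
    (∀ u : K, ι u = HahnSeries.single 0 u) ∧ ι D.z = HahnSeries.single 1 1 ∧
    ∀ a, D.ge 0 a → lge 0 (ι a) := by
  have hinj : Function.Injective ((HahnSeries.ofPowerSeries ℤ K).comp (D.toPS hK)) := by
    rw [RingHom.coe_comp]
    exact HahnSeries.ofPowerSeries_injective.comp (D.toPS_inj hK)
  refine ⟨IsFractionRing.lift (A := D.O) (K := L) hinj, ?_, ?_, ?_⟩
  · intro u
    have h := IsFractionRing.lift_algebraMap (A := D.O) (K := L) hinj ⟨u, D.K_ge hK u⟩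
    refine h.trans ?_
    rw [RingHom.comp_apply, D.approx_unique hK (D.toPS_spec hK ⟨u, D.K_ge hK u⟩) (D.approx_C hK u)]
    exact HahnSeries.ofPowerSeries_C u
  · have hz : D.ge 0 D.z := by simpa using D.ge_mono (by norm_num) (D.ge_z 1)
    have h := IsFractionRing.lift_algebraMap (A := D.O) (K := L) hinj ⟨D.z, hz⟩
    refine h.trans ?_
    rw [RingHom.comp_apply, D.approx_unique hK (D.toPS_spec hK ⟨D.z, hz⟩) D.approx_X]
    exact HahnSeries.ofPowerSeries_X
  · intro a ha n hn
    have h := IsFractionRing.lift_algebraMap (A := D.O) (K := L) hinj ⟨a, ha⟩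
    refine (congrArg (fun f => HahnSeries.coeff f n) h).trans ?_
    rw [RingHom.comp_apply]
    refine HahnSeries.embDomain_of_notMem_range ?_
    rintro ⟨m, hm⟩
    have : (m : ℤ) = n := hm
    omega
end DVField


set_option linter.unusedSectionVars false

namespace Lau
variable {F : Type} [Field F]

theorem lge_mono {j k : ℤ} {f : LaurentSeries F} (h : j ≤ k) (hf : lge k f) : lge j f :=
  fun n hn => hf n (by omega)

theorem lge_add {k : ℤ} {f g : LaurentSeries F} (hf : lge k f) (hg : lge k g) : lge k (f + g) := by
  intro n hn
  rw [HahnSeries.coeff_add, hf n hn, hg n hn, add_zero]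

theorem lge_neg {k : ℤ} {f : LaurentSeries F} (hf : lge k f) : lge k (-f) := by
  intro n hn
  rw [HahnSeries.coeff_neg, hf n hn, neg_zero]

theorem lge_sub {k : ℤ} {f g : LaurentSeries F} (hf : lge k f) (hg : lge k g) : lge k (f - g) := by
  rw [sub_eq_add_neg]; exact lge_add hf (lge_neg hg)

theorem lge_zero (k : ℤ) : lge k (0 : LaurentSeries F) := fun n _ => by simp

theorem lge_single (k : ℤ) (u : F) : lge k (HahnSeries.single k u : LaurentSeries F) := by
  intro n hn
  exact HahnSeries.coeff_single_of_ne (by omega)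

theorem lge_mul {j k : ℤ} {f g : LaurentSeries F} (hf : lge j f) (hg : lge k g) :
    lge (j + k) (f * g) := by
  intro n hn
  rw [HahnSeries.coeff_mul]
  refine Finset.sum_eq_zero fun x hx => ?_
  rw [Finset.mem_antidiagonal] at hx
  obtain ⟨-, -, h⟩ := hx
  rcases lt_or_ge x.1 j with h1 | h1
  · rw [hf _ h1, zero_mul]
  · rw [hg _ (by omega), mul_zero]

theorem lge_one : lge 0 (1 : LaurentSeries F) := lge_single 0 1

theorem lge_pow {k : ℤ} {f : LaurentSeries F} (hf : lge k f) (n : ℕ) : lge (n * k) (f ^ n) := by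
  induction n with
  | zero => simpa using lge_one
  | succ n ih =>
    rw [pow_succ]
    have := lge_mul ih hf
    push_cast
    rwa [add_mul, one_mul]

theorem lge_sum {ι : Type} (k : ℤ) (s : Finset ι) (f : ι → LaurentSeries F) (h : ∀ i ∈ s, lge k (f i)) :
    lge k (∑ i ∈ s, f i) := by
  induction s using Finset.induction_on with
  | empty => exact lge_zero k
  | insert a s ha ih =>
    rw [Finset.sum_insert ha]
    exact lge_add (h a (by simp)) (ih fun i hi => h i (by simp [hi]))

/-- coefficientwise operator -/
def E (c : ℤ → F →+ F) (f : LaurentSeries F) : LaurentSeries F where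
  coeff n := c n (f.coeff n)
  isPWO_support' := f.isPWO_support.mono (by
    intro n hn h
    apply hn
    simp only [h, map_zero])

theorem E_coeff (c : ℤ → F →+ F) (f : LaurentSeries F) (n : ℤ) : (E c f).coeff n = c n (f.coeff n) := rfl

theorem E_supp (c : ℤ → F →+ F) (f : LaurentSeries F) : (E c f).support ⊆ f.support := by
  intro n hn h
  apply hn
  rw [E_coeff, h, map_zero]

theorem E_add (c : ℤ → F →+ F) (f g : LaurentSeries F) : E c (f + g) = E c f + E c g := by
  ext n; simp [E_coeff]

theorem E_lge (c : ℤ → F →+ F) {k : ℤ} {f : LaurentSeries F} (h : lge k f) : lge k (E c f) := by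
  intro n hn
  rw [E_coeff, h n hn, map_zero]

theorem E_mul (c : ℤ → F →+ F) (hc : ∀ i j x y, c (i + j) (x * y) = x * c j y + y * c i x)
    (f g : LaurentSeries F) : E c (f * g) = f * E c g + g * E c f := by
  ext n
  rw [E_coeff, HahnSeries.coeff_add, mul_comm g, HahnSeries.coeff_mul,
    HahnSeries.coeff_mul_right' g.isPWO_support (E_supp c g),
    HahnSeries.coeff_mul_left' f.isPWO_support (E_supp c f), map_sum, ← Finset.sum_add_distrib]
  refine Finset.sum_congr rfl fun x hx => ?_
  rw [Finset.mem_antidiagonal] at hx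
  rw [← hx.2.2, hc, E_coeff, E_coeff, mul_comm (c x.1 _)]

theorem functional {L : Type} [Field L] {M : Type} [Field M] (ι : L →+* M) (e : M → M)
    (hadd : ∀ f g, e (f + g) = e f + e g) (hmul : ∀ f g, e (f * g) = f * e g + g * e f) :
    ∃ φ : Ω[L⁄ℤ] →+ M, (∀ a ω, φ (a • ω) = ι a * φ ω) ∧
      ∀ b, φ (KaehlerDifferential.D ℤ L b) = e (ι b) := by
  let _ : Module L M := Module.compHom M ι
  have hs : ∀ (a : L) (x : M), a • x = ι a * x := fun a x => rfl
  let e1 : L →+ M := AddMonoidHom.mk' (fun b => e (ι b)) (by intro a b; simp [hadd])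
  let d : Derivation ℤ L M := Derivation.mk' e1.toIntLinearMap (by
    intro a b
    change e (ι (a * b)) = a • e (ι b) + b • e (ι a)
    rw [map_mul, hmul, hs, hs])
  refine ⟨d.liftKaehlerDifferential.toAddMonoidHom, ?_, ?_⟩
  · intro a ω
    change d.liftKaehlerDifferential (a • ω) = _
    rw [map_smul]; rfl
  · intro b
    exact d.liftKaehlerDifferential_comp_D b

/-- coefficients for `z d/dz` -/
def cθ (F : Type) [Field F] (n : ℤ) : F →+ F := AddMonoidHom.mk' (fun x => n * x) (by intro a b; ring)

theorem cθ_leib (i j : ℤ) (x y : F) : cθ F (i + j) (x * y) = x * cθ F j y + y * cθ F i x := by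
  simp [cθ]; ring

/-- coefficients for a derivation of the constants -/
def cδ (δ : Derivation ℤ F F) (_ : ℤ) : F →+ F := δ.toLinearMap.toAddMonoidHom

theorem cδ_leib (δ : Derivation ℤ F F) (i j : ℤ) (x y : F) :
    cδ δ (i + j) (x * y) = x * cδ δ j y + y * cδ δ i x := δ.leibniz x y

theorem E_single (c : ℤ → F →+ F) (k : ℤ) (u : F) :
    E c (HahnSeries.single k u) = HahnSeries.single k (c k u) := by
  ext n
  rw [E_coeff]
  rcases eq_or_ne n k with rfl | h
  · simp
  · rw [HahnSeries.coeff_single_of_ne h, HahnSeries.coeff_single_of_ne h, map_zero]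

end Lau

namespace DVField
variable {L : Type} [Field L] (D : DVField L) {F : Type} [Field F]
  (ι : L →+* LaurentSeries F) (hz : ι D.z = HahnSeries.single 1 1)
  (h0 : ∀ a, D.ge 0 a → lge 0 (ι a))

open Lau
theorem iota_zpow (hz : ι D.z = HahnSeries.single 1 1) (k : ℤ) :
    ι (D.z ^ k) = HahnSeries.single k 1 := by
  rw [map_zpow₀, hz, ← RatFunc.single_zpow]

theorem iota_ge (hz : ι D.z = HahnSeries.single 1 1)
    (h0 : ∀ a, D.ge 0 a → lge 0 (ι a)) {k : ℤ} {a : L} (ha : D.ge k a) : lge k (ι a) := by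
  have h1 : a = D.z ^ k * (D.z ^ (-k) * a) := by
    rw [← mul_assoc, ← zpow_add₀ D.z_ne]; simp
  have h2 : D.ge 0 (D.z ^ (-k) * a) := by
    have := (D.ge_shift (-k) k a).2 ha
    simpa using this
  rw [h1, map_mul, D.iota_zpow ι hz]
  simpa using lge_mul (lge_single k (1:F)) (h0 _ h2)

theorem iota_coeff_ne (hz : ι D.z = HahnSeries.single 1 1)
    (h0 : ∀ a, D.ge 0 a → lge 0 (ι a)) {k : ℤ} {a : L} (ha : D.v a = k) : (ι a).coeff k ≠ 0 := by
  intro h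
  have hne : a ≠ 0 := by rintro rfl; rw [D.v_zero] at ha; exact absurd ha (by simp)
  have h1 : lge (k+1) (ι a) := by
    intro n hn
    rcases lt_or_eq_of_le (Int.lt_add_one_iff.1 hn) with h2 | rfl
    · exact D.iota_ge ι hz h0 ((D.v_eq_ge ha _).2 le_rfl) n h2
    · exact h
  have h2 : lge (-k) (ι a⁻¹) := D.iota_ge ι hz h0 ((D.v_eq_ge (D.v_inv ha) _).2 le_rfl)
  have h3 := lge_mul h1 h2
  rw [← map_mul, mul_inv_cancel₀ hne, map_one] at h3
  have := h3 0 (by omega)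
  simp at this

/-- bounds for a functional on `OmegaO` -/
theorem phi_OmegaO (h0 : ∀ a, D.ge 0 a → lge 0 (ι a)) (φ : Ω[L⁄ℤ] →+ LaurentSeries F)
    (hs : ∀ a ω, φ (a • ω) = ι a * φ ω) (k : ℤ)
    (hd : ∀ b, D.ge 0 b → lge k (φ (KaehlerDifferential.D ℤ L b))) (ω : Ω[L⁄ℤ]) (hω : ω ∈ D.OmegaO ℤ) :
    lge k (φ ω) := by
  unfold OmegaO at hω
  induction hω using AddSubgroup.closure_induction with
  | mem x hx =>
    obtain ⟨a, b, ha, hb, rfl⟩ := hx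
    rw [hs]
    simpa using lge_mul (h0 a ha) (hd b hb)
  | zero => rw [map_zero]; exact lge_zero k
  | add x y _ _ hx hy => rw [map_add]; exact lge_add hx hy
  | neg x _ hx => rw [map_neg]; exact lge_neg hx

theorem phi_OmegaOLog (h0 : ∀ a, D.ge 0 a → lge 0 (ι a)) (φ : Ω[L⁄ℤ] →+ LaurentSeries F)
    (hs : ∀ a ω, φ (a • ω) = ι a * φ ω) (k : ℤ)
    (hd : ∀ b, D.ge 0 b → lge k (φ (KaehlerDifferential.D ℤ L b)))
    (hl : lge k (φ (D.z⁻¹ • KaehlerDifferential.D ℤ L D.z))) (ω : Ω[L⁄ℤ]) (hω : ω ∈ D.OmegaOLog ℤ) :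
    lge k (φ ω) := by
  unfold OmegaOLog at hω
  induction hω using AddSubgroup.closure_induction with
  | mem x hx =>
    rcases hx with ⟨a, b, ha, hb, rfl⟩ | ⟨a, ha, rfl⟩
    · rw [hs]
      simpa using lge_mul (h0 a ha) (hd b hb)
    · rw [hs]
      simpa using lge_mul (h0 a ha) hl
  | zero => rw [map_zero]; exact lge_zero k
  | add x y _ _ hx hy => rw [map_add]; exact lge_add hx hy
  | neg x _ hx => rw [map_neg]; exact lge_neg hx

/-- the functional attached to `z d/dz` -/
theorem theta_Fil (p : ℕ) (hz : ι D.z = HahnSeries.single 1 1)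
    (h0 : ∀ a, D.ge 0 a → lge 0 (ι a)) :
    ∃ φ : Ω[L⁄ℤ] →+ LaurentSeries F, (∀ a ω, φ (a • ω) = ι a * φ ω) ∧
      (∀ b, φ (KaehlerDifferential.D ℤ L b) = E (cθ F) (ι b)) ∧
      ∀ s : ℕ, 1 ≤ s → ∀ ω ∈ D.FilOmega ℤ p s, lge (-(s:ℤ) + 1) (φ ω) := by
  obtain ⟨φ, hs, hd⟩ := functional ι (E (cθ F)) (E_add _) (E_mul _ cθ_leib)
  refine ⟨φ, hs, hd, fun s hs1 ω hω => ?_⟩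
  unfold FilOmega at hω
  split_ifs at hω with hp
  · obtain ⟨η, hη, rfl⟩ := hω
    rw [hs]
    have h1 : lge (-(s:ℤ)) (ι (D.z ^ s)⁻¹) := by
      have := D.iota_ge ι hz h0 (D.ge_z (-(s:ℤ)))
      simpa using this
    refine lge_mul h1 (D.phi_OmegaO ι h0 φ hs 1 ?_ η hη)
    intro b hb n hn
    rw [hd, E_coeff]
    rcases lt_or_eq_of_le (show n ≤ 0 by omega) with h2 | rfl
    · rw [h0 b hb n h2, map_zero]
    · simp [cθ]
  · obtain ⟨η, hη, rfl⟩ := hω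
    rw [hs]
    have h1 : lge (-(s:ℤ) + 1) (ι (D.z ^ (s-1))⁻¹) := by
      have := D.iota_ge ι hz h0 (D.ge_z (-((s - 1 : ℕ):ℤ)))
      rw [Nat.cast_sub hs1] at this
      rw [zpow_neg, ← Nat.cast_sub hs1, zpow_natCast] at this
      refine lge_mono ?_ this
      push_cast [Nat.cast_sub hs1]; omega
    have := lge_mul h1 (D.phi_OmegaOLog ι h0 φ hs 0 ?_ ?_ η hη)
    · simpa using this
    · intro b hb
      rw [hd]
      exact E_lge _ (h0 b hb)
    · rw [hs, hd, hz, E_single, map_inv₀, hz]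
      have : cθ F 1 1 = 1 := by simp [cθ]
      rw [this, inv_mul_cancel₀ (by simp)]
      exact lge_one

/-- the functional attached to a derivation of the constants -/
theorem delta_Fil (p : ℕ) (δ : Derivation ℤ F F) (hz : ι D.z = HahnSeries.single 1 1)
    (h0 : ∀ a, D.ge 0 a → lge 0 (ι a)) :
    ∃ φ : Ω[L⁄ℤ] →+ LaurentSeries F, (∀ a ω, φ (a • ω) = ι a * φ ω) ∧
      (∀ b, φ (KaehlerDifferential.D ℤ L b) = E (cδ δ) (ι b)) ∧
      ∀ s : ℕ, 1 ≤ s → ∀ ω ∈ D.FilOmega ℤ p s, lge (-(s:ℤ)) (φ ω) := by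
  obtain ⟨φ, hs, hd⟩ := functional ι (E (cδ δ)) (E_add _) (E_mul _ (cδ_leib δ))
  refine ⟨φ, hs, hd, fun s hs1 ω hω => ?_⟩
  have hb : ∀ b, D.ge 0 b → lge 0 (φ (KaehlerDifferential.D ℤ L b)) := by
    intro b hb
    rw [hd]
    exact E_lge _ (h0 b hb)
  have h1 : ∀ t ≤ s, lge (-(s:ℤ)) (ι (D.z ^ t)⁻¹) := by
    intro t ht
    have := D.iota_ge ι hz h0 (D.ge_z (-(t:ℤ)))
    rw [zpow_neg, zpow_natCast] at this
    exact lge_mono (by omega) this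
  unfold FilOmega at hω
  split_ifs at hω with hp
  · obtain ⟨η, hη, rfl⟩ := hω
    rw [hs]
    simpa using lge_mul (h1 s le_rfl) (D.phi_OmegaO ι h0 φ hs 0 hb η hη)
  · obtain ⟨η, hη, rfl⟩ := hω
    rw [hs]
    rw [← add_zero (-(s:ℤ))]
    refine lge_mul (h1 (s-1) (by omega)) (D.phi_OmegaOLog ι h0 φ hs 0 hb ?_ η hη)
    rw [hs, hd, hz, E_single]
    have : cδ δ 1 1 = 0 := δ.map_one_eq_zero
    rw [this]
    simpa using lge_zero 0

end DVField


set_option linter.unusedSectionVars false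

namespace DVField
section
variable {L : Type} [Field L] (D : DVField L) {p : ℕ} [Fact p.Prime]

theorem wFd_eq {n : ℕ} (x : TruncatedWittVector p n L) :
    wFd p ℤ x = WittAux.fd p n x.out.coeff := by
  unfold wFd WittAux.fd
  rw [Finset.sum_range]
  refine Finset.sum_congr rfl fun i _ => ?_
  rw [TruncatedWittVector.coeff_out]

theorem wFd_add {n : ℕ} (x y : TruncatedWittVector p (n+1) L) :
    wFd p ℤ (x + y) = wFd p ℤ x + wFd p ℤ y := by
  rw [wFd_eq, wFd_eq, wFd_eq, ← WittAux.fd_add]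
  unfold WittAux.fd
  refine Finset.sum_congr rfl fun i hi => ?_
  rw [out_of_lt _ i (by simpa using hi), tr_add]

theorem wFd_zero {n : ℕ} [CharP L p] (x : TruncatedWittVector p n L)
    (h : ∀ i, ∃ y, x.coeff i = y ^ p) : wFd p ℤ x = 0 := by
  unfold wFd
  refine Finset.sum_eq_zero fun i _ => ?_
  obtain ⟨y, hy⟩ := h i
  have : (KaehlerDifferential.D ℤ L) (x.coeff i) = 0 := by
    rw [hy, Derivation.leibniz_pow, ← Nat.cast_smul_eq_nsmul L, CharP.cast_eq_zero, zero_smul]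
  rw [this, smul_zero]

theorem wR_eq {n : ℕ} (x : TruncatedWittVector p (n+1) L) :
    wR x = TruncatedWittVector.truncate (Nat.le_succ n) x := by
  ext i
  rw [TruncatedWittVector.coeff_truncate]
  rfl

theorem p_smul_coeff [CharP L p] {n : ℕ} (x : TruncatedWittVector p (n+1) L) (i : Fin (n+1)) :
    (p • x).coeff i = (x.out * (p : WittVector p L)).coeff i := by
  conv_lhs => rw [← TruncatedWittVector.truncateFun_out x, ← WittVector.truncateFun_nsmul]
  rw [WittVector.coeff_truncateFun, nsmul_eq_mul, mul_comm]

theorem wP_wR [CharP L p] {n : ℕ} (x : TruncatedWittVector p (n+1) L) : wP (wR x) = p • x := by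
  ext i
  unfold wP
  rw [p_smul_coeff, p_smul_coeff]
  obtain ⟨i, hi⟩ := i
  rcases i with _ | i
  · simp only [WittVector.mul_charP_coeff_zero]
  · simp only [WittVector.mul_charP_coeff_succ]
    rw [out_of_lt _ i (by omega), out_of_lt _ i (by omega)]
    simp only [wRes, wR, TruncatedWittVector.coeff_mk]
    rw [dif_pos (by omega)]
    rfl

theorem wP_pow [CharP L p] {n : ℕ} (x : TruncatedWittVector p n L) (i : Fin (n+1)) :
    ∃ y, (wP x).coeff i = y ^ p := by
  unfold wP
  rw [p_smul_coeff]
  obtain ⟨i, hi⟩ := i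
  rcases i with _ | i
  · exact ⟨0, by simp only [WittVector.mul_charP_coeff_zero, zero_pow (Fact.out : p.Prime).ne_zero]⟩
  · exact ⟨_, by simp only [WittVector.mul_charP_coeff_succ]; rfl⟩

theorem add_low {n k : ℕ} (x y : TruncatedWittVector p n L) (h : ∀ i : Fin n, (i:ℕ) < k → y.coeff i = 0)
    (i : Fin n) (hi : (i:ℕ) < k) : (x + y).coeff i = x.coeff i := by
  have h1 : WittVector.truncate k y.out = 0 := by
    ext j
    rw [WittVector.coeff_truncate, TruncatedWittVector.coeff_zero]
    rcases lt_or_ge (j:ℕ) n with hj | hj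
    · rw [out_of_lt y j hj]; exact h ⟨j, hj⟩ j.2
    · exact out_of_ge y j hj
  have h2 : WittVector.truncate k (x.out + y.out) = WittVector.truncate k x.out := by
    rw [map_add, h1, add_zero]
  have h3 := congrArg (fun t => TruncatedWittVector.coeff ⟨i, hi⟩ t) h2
  simp only [WittVector.coeff_truncate] at h3
  rw [tr_add, h3, TruncatedWittVector.coeff_out]

theorem wVit_low {e n : ℕ} (b : TruncatedWittVector p e L) (i : Fin n) (hi : (i:ℕ) < n - e) :
    (wVit b : TruncatedWittVector p n L).coeff i = 0 := by
  unfold wVit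
  rw [TruncatedWittVector.coeff_mk, dif_neg (by omega)]

theorem wVit_log {e n r : ℕ} (hn : e ≤ n) {b : TruncatedWittVector p e L} (hb : b ∈ D.filLog p r e) :
    (wVit b : TruncatedWittVector p n L) ∈ D.filLog p r n := by
  unfold filLog at *
  simp only [Set.mem_ofPred_eq, D.log_iff] at *
  intro i
  unfold wVit
  rw [TruncatedWittVector.coeff_mk]
  split_ifs with h
  · have := hb ⟨i - (n - e), h.2⟩
    have h2 : n - 1 - (i:ℕ) = e - 1 - ((i:ℕ) - (n - e)) := by have := i.2; omega
    rw [h2]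
    exact this
  · rw [zero_pow (pow_ne_zero _ (Fact.out : p.Prime).ne_zero)]
    exact D.ge_zero _

theorem log_mono {n r s : ℕ} (h : r ≤ s) {x : TruncatedWittVector p (n+1) L} (hx : x ∈ D.filLog p r (n+1)) :
    x ∈ D.filLog p s (n+1) := by
  rw [mem_filLog] at *
  exact fun i => D.ge_mono (by omega) (hx i)

variable [CharP L p]

theorem mem_filKM {s n : ℕ} (hs : 1 ≤ s) (x : TruncatedWittVector p (n+1) L) :
    x ∈ D.filKM p s (n+1) ↔ x ∈ D.filLog p s (n+1) ∧
      ∀ i : Fin (n+1), (i:ℕ) < n + 1 - min (padicValNat p s) (n+1) →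
        D.ge (-((s-1 : ℕ):ℤ)) (x.coeff i ^ p ^ (n - (i:ℕ))) := by
  have hp0 : ∀ k, p ^ k ≠ 0 := fun k => pow_ne_zero _ (Fact.out : p.Prime).ne_zero
  unfold filKM
  rw [if_neg (by omega)]
  constructor
  · rintro ⟨a, ha, b, hb, rfl⟩
    refine ⟨D.log_add (D.log_mono (by omega) ha) (D.wVit_log (min_le_right _ _) hb), ?_⟩
    intro i hi
    rw [add_low a (wVit b) (fun i hi => wVit_low b i hi) i hi]
    exact (D.mem_filLog a).1 ha i
  · rintro ⟨h1, h2⟩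
    set e := min (padicValNat p s) (n+1) with he
    have hen : e ≤ n + 1 := min_le_right _ _
    let a : TruncatedWittVector p (n+1) L := TruncatedWittVector.mk p fun i =>
      if (i:ℕ) < n + 1 - e then x.coeff i else 0
    let b : TruncatedWittVector p e L := TruncatedWittVector.mk p fun j =>
      x.coeff ⟨j + (n + 1 - e), by have := j.2; omega⟩
    refine ⟨a, ?_, b, ?_, ?_⟩
    · rw [mem_filLog]
      intro i
      simp only [a, TruncatedWittVector.coeff_mk]
      split_ifs with h
      · exact h2 i h
      · rw [zero_pow (hp0 _)]; exact D.ge_zero _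
    · unfold filLog
      simp only [Set.mem_ofPred_eq, D.log_iff]
      intro j
      have := (D.mem_filLog x).1 h1 ⟨j + (n + 1 - e), by have := j.2; omega⟩
      simp only [b, TruncatedWittVector.coeff_mk]
      have h3 : e - 1 - (j:ℕ) = n - (j + (n + 1 - e)) := by have := j.2; omega
      rw [h3]
      exact this
    · have hv : ∀ i : Fin (n+1), (wVit b : TruncatedWittVector p (n+1) L).coeff i
          = if (i:ℕ) < n + 1 - e then 0 else x.coeff i := by
        intro i
        split_ifs with h
        · exact wVit_low b i h
        · unfold wVit
          rw [TruncatedWittVector.coeff_mk, dif_pos (by have := i.2; omega)]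
          simp only [b, TruncatedWittVector.coeff_mk]
          congr 1
          apply Fin.ext
          simp only
          omega
      ext i
      rw [add_disj]
      · rw [hv]
        simp only [a, TruncatedWittVector.coeff_mk]
        split_ifs <;> simp
      · intro i
        rw [hv]
        simp only [a, TruncatedWittVector.coeff_mk]
        split_ifs <;> simp

theorem zero_filKM {s n : ℕ} (hs : 1 ≤ s) : (0 : TruncatedWittVector p (n+1) L) ∈ D.filKM p s (n+1) := by
  rw [D.mem_filKM hs]
  refine ⟨D.log_zero, fun i _ => ?_⟩
  rw [TruncatedWittVector.coeff_zero, zero_pow (pow_ne_zero _ (Fact.out : p.Prime).ne_zero)]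
  exact D.ge_zero _

theorem filKM_FilP {s n : ℕ} (hs : 1 ≤ s) {x : TruncatedWittVector p (n+1) L} (hx : x ∈ D.filKM p s (n+1)) :
    x ∈ D.FilP p s (n+1) := by
  refine ⟨Fin.cons x (fun _ => 0), ?_, ?_⟩
  · intro j
    refine Fin.cases ?_ (fun j => ?_) j
    · simpa using hx
    · rw [Fin.cons_succ]
      exact D.zero_filKM (Nat.mul_pos hs (pow_pos (Fact.out : p.Prime).pos _))
  · rw [Fin.sum_univ_succ]
    simp

theorem wR_filKM {r s n : ℕ} (hr : 1 ≤ r) {x : TruncatedWittVector p (n+2) L}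
    (hx : x ∈ D.filKM p (r * p ^ (s+1)) (n+2)) : wR x ∈ D.filKM p (r * p ^ s) (n+1) := by
  have hp := (Fact.out : p.Prime)
  have h1 : 1 ≤ r * p ^ s := Nat.mul_pos hr (pow_pos hp.pos _)
  have h2 : 1 ≤ r * p ^ (s+1) := Nat.mul_pos hr (pow_pos hp.pos _)
  have hval : padicValNat p (r * p ^ (s+1)) = padicValNat p (r * p ^ s) + 1 := by
    rw [pow_succ, ← mul_assoc, padicValNat.mul (by omega) hp.ne_zero, padicValNat_self]
  rw [D.mem_filKM h2] at hx
  rw [D.mem_filKM h1]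
  obtain ⟨hx1, hx2⟩ := hx
  rw [mem_filLog] at hx1 ⊢
  have key : ∀ (i : Fin (n+1)), x.coeff i.castSucc ^ p ^ (n + 1 - (i:ℕ)) =
      (x.coeff i.castSucc ^ p ^ (n - (i:ℕ))) ^ p := by
    intro i
    rw [← pow_mul, ← pow_succ]
    congr 2
    have := i.2
    omega
  have hc : ∀ i : Fin (n+1), (wR x).coeff i = x.coeff i.castSucc := fun i => rfl
  have hlow : ∀ (a : L) (t u : ℕ), t < p * (u + 1) → D.ge (-(t:ℤ)) (a ^ p) → D.ge (-(u:ℤ)) a := by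
    intro a t u htu ha
    by_cases h0 : a = 0
    · rw [h0]; exact D.ge_zero _
    obtain ⟨k, hk⟩ := D.exists_v h0
    rw [D.v_eq_ge hk]
    rw [D.v_eq_ge (D.v_pow_eq hk p)] at ha
    by_contra hcon
    have h3 : k ≤ -((u:ℤ) + 1) := by omega
    have h4 : (p:ℤ) * k ≤ p * (-((u:ℤ) + 1)) := mul_le_mul_of_nonneg_left h3 (by positivity)
    zify at htu
    linarith
  refine ⟨fun i => ?_, fun i hi => ?_⟩
  · have := hx1 i.castSucc
    rw [Fin.val_castSucc, key] at this
    rw [hc]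
    refine hlow _ _ _ ?_ this
    have := hp.pos
    rw [pow_succ]
    nlinarith
  · have := hx2 i.castSucc (by rw [hval, Fin.val_castSucc]; omega)
    rw [Fin.val_castSucc, key] at this
    rw [hc]
    refine hlow _ _ _ ?_ this
    rw [Nat.sub_add_cancel h1]
    have : p * (r * p ^ s) = r * p ^ (s+1) := by rw [pow_succ]; ring
    omega

theorem decomp {r m : ℕ} (hr : 1 ≤ r) {a : TruncatedWittVector p (m+1) L} (ha : a ∈ D.FilP p r (m+1)) :
    ∃ f ∈ D.filKM p r (m+1), ∃ c ∈ D.FilP p r m, a = f + wP c := by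
  obtain ⟨f, hf, rfl⟩ := ha
  refine ⟨f 0, by simpa using hf 0, wR (∑ s : Fin m, p ^ (s:ℕ) • f s.succ), ?_, ?_⟩
  · refine ⟨fun s => wR (f s.succ), ?_, ?_⟩
    · intro s
      obtain ⟨k, rfl⟩ : ∃ k, m = k + 1 := ⟨m - 1, by have := s.2; omega⟩
      exact D.wR_filKM hr (by simpa using hf s.succ)
    · simp only [wR_eq, map_sum, map_nsmul]
  · rw [wP_wR, Fin.sum_univ_succ, Finset.smul_sum]
    simp only [Fin.val_zero, pow_zero, one_smul, Fin.val_succ, pow_succ', mul_smul]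

end
end DVField


set_option linter.unusedSectionVars false

namespace DVField
section
open Lau
variable {L : Type} [Field L] (D : DVField L) {p : ℕ} [Fact p.Prime] {F : Type} [Field F]
  (ι : L →+* LaurentSeries F)

theorem term_lge (hz : ι D.z = HahnSeries.single 1 1)
    (h0 : ∀ a, D.ge 0 a → lge 0 (ι a)) (c : ℤ → F →+ F) {q : ℕ} (hq : 1 ≤ q) {s : ℤ} {y : L}
    (hy : D.ge s (y ^ q)) : lge s (ι (y ^ (q-1)) * E c (ι y)) := by
  by_cases hy0 : y = 0
  · have : E c (ι y) = 0 := by ext n; rw [hy0, map_zero, E_coeff]; simp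
    rw [this, mul_zero]; exact lge_zero s
  obtain ⟨k, hk⟩ := D.exists_v hy0
  rw [D.v_eq_ge (D.v_pow_eq hk q)] at hy
  have h1 : lge k (ι y) := D.iota_ge ι hz h0 ((D.v_eq_ge hk _).2 le_rfl)
  have h2 := lge_mul (lge_pow h1 (q-1)) (E_lge c h1)
  rw [map_pow]
  refine lge_mono (hy.trans (le_of_eq ?_)) h2
  push_cast [Nat.cast_sub hq]
  ring

theorem term_theta (hz : ι D.z = HahnSeries.single 1 1)
    (h0 : ∀ a, D.ge 0 a → lge 0 (ι a)) {q : ℕ} (hq : 1 ≤ q) {y : L} {k : ℤ} (hk : D.v y = k) :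
    (ι (y ^ (q-1)) * E (cθ F) (ι y)).coeff (q * k) = k * (ι (y ^ q)).coeff (q * k) := by
  have h1 : lge k (ι y) := D.iota_ge ι hz h0 ((D.v_eq_ge hk _).2 le_rfl)
  have h2 : lge (k+1) (E (cθ F) (ι y) - HahnSeries.single 0 (k:F) * ι y) := by
    intro n hn
    have h3 : (HahnSeries.single 0 (k:F) * ι y).coeff n = k * (ι y).coeff n := by
      have := HahnSeries.coeff_single_mul_add (r := (k:F)) (x := ι y) (a := n) (b := (0:ℤ))
      simpa using this
    rw [HahnSeries.coeff_sub, h3, E_coeff]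
    rcases lt_or_eq_of_le (Int.lt_add_one_iff.1 hn) with h2 | rfl
    · rw [h1 n h2]; simp
    · simp [cθ]
  have h3 := lge_mul (lge_pow h1 (q-1)) h2 (q*k) (by push_cast [Nat.cast_sub hq]; linarith)
  rw [mul_sub, HahnSeries.coeff_sub, sub_eq_zero] at h3
  rw [map_pow, h3, mul_left_comm, ← pow_succ, Nat.sub_add_cancel hq, map_pow]
  have := HahnSeries.coeff_single_mul_add (r := (k:F)) (x := ι y ^ q) (a := (q * k : ℤ)) (b := (0:ℤ))
  simpa using this

variable [CharP L p] [CharP F p]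

theorem stepB (hz : ι D.z = HahnSeries.single 1 1)
    (h0 : ∀ a, D.ge 0 a → lge 0 (ι a)) {s m : ℕ} (hs : 1 ≤ s) {y : TruncatedWittVector p (m+1) L}
    (hy : y ∈ D.filLog p s (m+1)) (h : wFd p ℤ y ∈ D.FilOmega ℤ p s) : y ∈ D.filKM p s (m+1) := by
  have hp := (Fact.out : p.Prime)
  rw [D.mem_filKM hs]
  refine ⟨hy, fun i0 hi0 => ?_⟩
  rw [mem_filLog] at hy
  have hval : ∀ j : ℕ, p ^ j ∣ s ↔ j ≤ padicValNat p s := fun j =>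
    padicValNat_dvd_iff_le (by omega)
  have hsplit : ∀ i : Fin (m+1), ¬ D.ge (-((s-1:ℕ):ℤ)) (y.coeff i ^ p ^ (m - (i:ℕ))) →
      ∃ k : ℤ, D.v (y.coeff i) = k ∧ ((p ^ (m - (i:ℕ)) : ℕ):ℤ) * k = -(s:ℤ) := by
    intro i hi
    have hne : y.coeff i ≠ 0 := by
      intro h
      apply hi
      rw [h, zero_pow (pow_ne_zero _ hp.ne_zero)]
      exact D.ge_zero _
    obtain ⟨k, hk⟩ := D.exists_v hne
    refine ⟨k, hk, ?_⟩
    rw [D.v_eq_ge (D.v_pow_eq hk _)] at hi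
    have h2 := hy i
    rw [D.v_eq_ge (D.v_pow_eq hk _)] at h2
    omega
  have hdvd : ∀ (i : Fin (m+1)) (k : ℤ), ((p ^ (m - (i:ℕ)) : ℕ):ℤ) * k = -(s:ℤ) →
      m - (i:ℕ) ≤ padicValNat p s := by
    intro i k hk
    rw [← hval]
    have : ((p ^ (m - (i:ℕ)) : ℕ):ℤ) ∣ (s:ℤ) := ⟨-k, by linarith⟩
    exact_mod_cast this
  have hndvd : ∀ (i : Fin (m+1)) (k : ℤ), ((p ^ (m - (i:ℕ)) : ℕ):ℤ) * k = -(s:ℤ) →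
      ((p:ℤ) ∣ k ↔ m - (i:ℕ) < padicValNat p s) := by
    intro i k hk
    rw [← Nat.succ_le_iff, ← hval, Nat.succ_eq_add_one, pow_succ]
    have hpos : ((p ^ (m - (i:ℕ)) : ℕ):ℤ) ≠ 0 := by
      exact_mod_cast pow_ne_zero _ hp.ne_zero
    rw [← Int.natCast_dvd_natCast, ← dvd_neg (b := (s:ℤ)), ← hk, Nat.cast_mul,
      mul_dvd_mul_iff_left hpos]
  by_contra hcon
  obtain ⟨φ, hs1, hd, hfil⟩ := D.theta_Fil ι p hz h0
  have hφ := hfil s hs _ h (-(s:ℤ)) (by omega)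
  unfold wFd at hφ
  rw [map_sum] at hφ
  have hcs : ∀ (t : Finset (Fin (m+1))) (f : Fin (m+1) → LaurentSeries F) (n : ℤ),
      (∑ i ∈ t, f i).coeff n = ∑ i ∈ t, (f i).coeff n := by
    intro t f n
    induction t using Finset.induction_on with
    | empty => simp
    | insert a t ha ih => rw [Finset.sum_insert ha, Finset.sum_insert ha, HahnSeries.coeff_add, ih]
  rw [hcs] at hφ
  simp only [hs1, hd, Nat.add_sub_cancel] at hφ
  obtain ⟨k0, hk0, hq0⟩ := hsplit i0 hcon
  have hj0 : m - (i0:ℕ) = padicValNat p s := by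
    have := hdvd i0 k0 hq0
    have := i0.2
    omega
  rw [Finset.sum_eq_single i0] at hφ
  · have hq : 1 ≤ p ^ (m - (i0:ℕ)) := Nat.one_le_pow _ _ hp.pos
    have h1 := D.term_theta ι hz h0 hq hk0
    rw [hq0, hφ] at h1
    rcases mul_eq_zero.1 h1.symm with h2 | h2
    · rw [CharP.intCast_eq_zero_iff F p, hndvd i0 k0 hq0] at h2
      omega
    · rw [← hq0] at h2
      exact D.iota_coeff_ne ι hz h0 (D.v_pow_eq hk0 _) h2
  · intro i _ hne
    have hq : 1 ≤ p ^ (m - (i:ℕ)) := Nat.one_le_pow _ _ hp.pos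
    by_cases hi : D.ge (-((s-1:ℕ):ℤ)) (y.coeff i ^ p ^ (m - (i:ℕ)))
    · exact D.term_lge ι hz h0 (cθ F) hq hi _ (by omega)
    · obtain ⟨k, hk, hqk⟩ := hsplit i hi
      have h1 := D.term_theta ι hz h0 hq hk
      rw [hqk] at h1
      rw [h1]
      have h2 : (p:ℤ) ∣ k := by
        rw [hndvd i k hqk]
        have := hdvd i k hqk
        have h3 : (i:ℕ) ≠ i0 := fun h => hne (Fin.ext h)
        have := i.2
        have := i0.2
        omega
      rw [(CharP.intCast_eq_zero_iff F p k).2 h2, zero_mul]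
  · simp

end

section
open Lau
variable {L : Type} [Field L] (D : DVField L) {p : ℕ} [Fact p.Prime] [CharP L p]
  {K : Subfield L}

theorem stepA (hK : D.IsCoeffField K) (ι : L →+* LaurentSeries K) (hz : ι D.z = HahnSeries.single 1 1)
    (hu : ∀ u : K, ι u = HahnSeries.single 0 u)
    (h0 : ∀ a, D.ge 0 a → lge 0 (ι a)) {r m : ℕ} (hr : 2 ≤ r) {f : TruncatedWittVector p (m+1) L}
    (hf : f ∈ D.filKM p r (m+1)) (h : wFd p ℤ f ∈ D.FilOmega ℤ p (r-1)) :
    ∃ g ∈ D.filKM p r (m+1), (∀ i, ∃ y, g.coeff i = y ^ p) ∧ f - g ∈ D.filLog p (r-1) (m+1) := by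
  have hp := (Fact.out : p.Prime)
  have hp0 : ∀ k, p ^ k ≠ 0 := fun k => pow_ne_zero _ hp.ne_zero
  have : CharP K p := (K.subtype.charP_iff K.subtype.injective p).2 inferInstance
  have hval : ∀ j : ℕ, p ^ j ∣ r ↔ j ≤ padicValNat p r := fun j =>
    padicValNat_dvd_iff_le (by omega)
  have hmem := hf
  unfold filKM at hmem
  rw [if_neg (by omega)] at hmem
  obtain ⟨a, ha, b, hb, hab⟩ := hmem
  set b' : TruncatedWittVector p (m+1) L := wVit b with hb'
  have hb'log : b' ∈ D.filLog p r (m+1) := D.wVit_log (min_le_right _ _) hb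
  have hb'low : ∀ i : Fin (m+1), ¬ m - (i:ℕ) < padicValNat p r → b'.coeff i = 0 := by
    intro i hi
    exact wVit_low b i (by have := i.2; omega)
  have hex : ∀ i : ℕ, ∃ u : K, ∀ hi : i < m + 1, (¬ m - i < padicValNat p r → u = 0) ∧
      D.ge (-(r:ℤ) + p ^ (m - i)) ((b'.coeff ⟨i, hi⟩ - u * D.z ^ (-((r / p ^ (m - i) : ℕ):ℤ))) ^ p ^ (m - i)) := by
    intro i
    by_cases hi : i < m + 1
    swap
    · exact ⟨0, fun h => absurd h hi⟩
    by_cases hj : m - i < padicValNat p r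
    swap
    · refine ⟨0, fun _ => ⟨fun _ => rfl, ?_⟩⟩
      rw [hb'low ⟨i, hi⟩ hj, ZeroMemClass.coe_zero, zero_mul, sub_zero, zero_pow (hp0 _)]
      exact D.ge_zero _
    have hd : p ^ (m - i) * (r / p ^ (m - i)) = r := Nat.mul_div_cancel' ((hval _).2 hj.le)
    set e := r / p ^ (m - i) with he
    have h1 := (D.mem_filLog b').1 hb'log ⟨i, hi⟩
    have hre : -(r:ℤ) = ((p ^ (m - i) : ℕ):ℤ) * (-(e:ℤ)) := by
      rw [mul_neg, ← Nat.cast_mul, hd]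
    simp only at h1
    rw [hre, D.ge_pow_iff (Nat.pos_of_ne_zero (hp0 _))] at h1
    have h2 := (D.ge_shift (e:ℤ) _ _).2 h1
    rw [add_neg_cancel] at h2
    obtain ⟨u, hu, h3⟩ := hK.2 _ h2
    refine ⟨⟨u, hu⟩, fun _ => ⟨fun h => absurd hj h, ?_⟩⟩
    have h4 := (D.ge_shift (-(e:ℤ)) 1 _).2 h3
    have h5 : D.z ^ (-(e:ℤ)) * (D.z ^ (e:ℤ) * b'.coeff ⟨i, hi⟩ - u)
        = b'.coeff ⟨i, hi⟩ - u * D.z ^ (-(e:ℤ)) := by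
      rw [mul_sub, ← mul_assoc, ← zpow_add₀ D.z_ne, neg_add_cancel, zpow_zero, one_mul, mul_comm u]
    rw [h5, ← D.ge_pow_iff (Nat.pos_of_ne_zero (hp0 (m - i)))] at h4
    refine D.ge_mono (le_of_eq ?_) h4
    rw [hre]; push_cast; ring
  choose u hu1 using hex
  let g : TruncatedWittVector p (m+1) L := TruncatedWittVector.mk p fun i =>
    u i * D.z ^ (-((r / p ^ (m - (i:ℕ)) : ℕ):ℤ))
  have hg : ∀ i : Fin (m+1), g.coeff i = u i * D.z ^ (-((r / p ^ (m - (i:ℕ)) : ℕ):ℤ)) :=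
    fun i => by simp only [g, TruncatedWittVector.coeff_mk]
  have hglow : ∀ i : Fin (m+1), ¬ m - (i:ℕ) < padicValNat p r → g.coeff i = 0 := by
    intro i hi
    rw [hg, (hu1 i i.2).1 hi, ZeroMemClass.coe_zero, zero_mul]
  have hclose : ∀ i : Fin (m+1), D.ge (-(r:ℤ) + p ^ (m - (i:ℕ)))
      ((b'.coeff i - g.coeff i) ^ p ^ (m - (i:ℕ))) := by
    intro i
    rw [hg]
    exact (hu1 i i.2).2
  have hglog : g ∈ D.filLog p r (m+1) := by
    rw [mem_filLog]
    intro i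
    have h1 := (D.mem_filLog b').1 hb'log i
    have h2 := D.ge_mono (j := -(r:ℤ)) (by have : (0:ℤ) ≤ (p:ℤ) ^ (m - (i:ℕ)) := by positivity
                                           omega) (hclose i)
    have h3 := D.ge_sub h1 h2
    rwa [← sub_pow_char_pow, sub_sub_cancel] at h3
  have hgKM : g ∈ D.filKM p r (m+1) := by
    rw [D.mem_filKM (by omega)]
    refine ⟨hglog, fun i hi => ?_⟩
    rw [hglow i (by omega), zero_pow (hp0 _)]
    exact D.ge_zero _
  have hy : f - g ∈ D.filLog p (r-1) (m+1) := by
    have h1 := D.log_add ha (D.log_close (by omega) hb'log hglog hclose)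
    rwa [hab, add_sub_assoc]
  refine ⟨g, hgKM, ?_, hy⟩
  have hcart := Cartier.main p m u ?_
  · intro i
    by_cases hi : m - (i:ℕ) < padicValNat p r
    · obtain ⟨w, hw⟩ := hcart i (by omega)
      have hd : p ^ (m - (i:ℕ) + 1) ∣ r := (hval _).2 hi
      obtain ⟨t, ht⟩ := hd
      have h1 : r / p ^ (m - (i:ℕ)) = p * t := by
        rw [ht, pow_succ, mul_assoc, Nat.mul_div_cancel_left _ (Nat.pos_of_ne_zero (hp0 _))]
      refine ⟨w * D.z ^ (-(t:ℤ)), ?_⟩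
      rw [hg, h1, hw, mul_pow, ← zpow_natCast (D.z ^ (-(t:ℤ))), ← zpow_mul]
      congr 2
      push_cast; ring
    · exact ⟨0, by rw [hglow i hi, zero_pow hp.ne_zero]⟩
  · intro δ
    obtain ⟨φ, hs1, hd, hfil⟩ := D.delta_Fil ι p δ hz h0
    have hφ := hfil (r-1) (by omega) _ h
    have hsum : wFd p ℤ f = wFd p ℤ (f - g) + wFd p ℤ g := by
      rw [← wFd_add, sub_add_cancel]
    have hφy : lge (-((r-1:ℕ):ℤ)) (φ (wFd p ℤ (f - g))) := by
      unfold wFd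
      rw [map_sum]
      refine lge_sum _ _ _ fun i _ => ?_
      rw [hs1, hd, Nat.add_sub_cancel]
      exact D.term_lge ι hz h0 _ (Nat.one_le_pow _ _ hp.pos) ((D.mem_filLog _).1 hy i)
    have hφg : lge (-((r-1:ℕ):ℤ)) (φ (wFd p ℤ g)) := by
      have := lge_sub hφ hφy
      rwa [hsum, map_add, add_sub_cancel_left] at this
    have hval : φ (wFd p ℤ g) = HahnSeries.single (-(r:ℤ))
        (∑ i ∈ Finset.range (m+1), u i ^ (p ^ (m - i) - 1) * δ (u i)) := by
      unfold wFd
      change _ = HahnSeries.single.addMonoidHom (-(r:ℤ)) _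
      rw [map_sum, map_sum, Finset.sum_range]
      refine Finset.sum_congr rfl fun i _ => ?_
      rw [hs1, hd, Nat.add_sub_cancel]
      by_cases hi : m - (i:ℕ) < padicValNat p r
      · have hdv : p ^ (m - (i:ℕ)) * (r / p ^ (m - (i:ℕ))) = r := Nat.mul_div_cancel' ((hval _).2 hi.le)
        rw [hg, map_pow]
        have h1 : ι (u i * D.z ^ (-((r / p ^ (m - (i:ℕ)) : ℕ):ℤ)))
            = HahnSeries.single (-((r / p ^ (m - (i:ℕ)) : ℕ):ℤ)) (u i) := by
          rw [map_mul, hu, D.iota_zpow ι hz, HahnSeries.single_mul_single, zero_add, mul_one]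
        rw [h1, E_single, HahnSeries.single_pow, HahnSeries.single_mul_single]
        have hq : 1 ≤ p ^ (m - (i:ℕ)) := Nat.one_le_pow _ _ hp.pos
        have he : (p ^ (m - (i:ℕ)) - 1) • (-((r / p ^ (m - (i:ℕ)) : ℕ):ℤ))
            + -((r / p ^ (m - (i:ℕ)) : ℕ):ℤ) = -(r:ℤ) := by
          rw [← succ_nsmul, Nat.sub_add_cancel hq, nsmul_eq_mul, mul_neg, ← Nat.cast_mul, hdv]
        rw [he]
        rfl
      · rw [hglow i hi, (hu1 i i.2).1 hi, map_zero, map_zero]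
        have : E (cδ δ) (0 : LaurentSeries K) = 0 := by ext n; simp [E_coeff]
        rw [this, mul_zero, mul_zero, map_zero]
    have h3 := hφg (-(r:ℤ)) (by omega)
    rwa [hval, HahnSeries.coeff_single_same] at h3

end
end DVField

/-- (Weight-zero case of the first exact sequence of lem:gr-ex.)  Assume `O`
is henselian and admits a coefficient field `K ⊆ O`.  Let `n = m+1 ≥ 1` and `r ≥ 2`.  If
`a ∈ Fil^p_r Wₙ(L)` satisfies `F^{n-1}d(a) ∈ FilΩ_{r-1}`, then
`a ∈ (F(W_{n+1}(L)) ∩ Fil^p_r Wₙ(L)) + Fil^p_{r-1} Wₙ(L) + p̲(Fil^p_r W_{n-1}(L))`, where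
`F(W_{n+1}(L))` is the set of Witt vectors all of whose components are `p`-th powers. -/
theorem statement10 (p : ℕ) [Fact p.Prime] (L : Type) [Field L] [CharP L p]
    (D : DVField L) (hhens : D.IsHenselian) (K : Subfield L) (hK : D.IsCoeffField K)
    (m r : ℕ) (hr : 2 ≤ r)
    (a : TruncatedWittVector p (m + 1) L) (ha : a ∈ D.FilP p r (m + 1))
    (h2 : wFd p ℤ a ∈ D.FilOmega ℤ p (r - 1)) :
    ∃ g : TruncatedWittVector p (m + 1) L,
      (∀ i : Fin (m + 1), ∃ y : L, g.coeff i = y ^ p) ∧ g ∈ D.FilP p r (m + 1) ∧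
      ∃ b ∈ D.FilP p (r - 1) (m + 1), ∃ c ∈ D.FilP p r m, a = g + b + wP c := by
  obtain ⟨f, hf, c, hc, rfl⟩ := D.decomp (by omega) ha
  obtain ⟨ι, hu, hz, h0⟩ := D.exists_iota hK
  have : CharP K p := (K.subtype.charP_iff K.subtype.injective p).2 inferInstance
  rw [DVField.wFd_add, DVField.wFd_zero (wP c) (DVField.wP_pow c), add_zero] at h2
  obtain ⟨g, hg, hgp, hy⟩ := D.stepA hK ι hz hu h0 hr hf h2
  have hsum : wFd p ℤ f = wFd p ℤ (f - g) + wFd p ℤ g := by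
    rw [← DVField.wFd_add, sub_add_cancel]
  rw [hsum, DVField.wFd_zero g hgp, add_zero] at h2
  refine ⟨g, hgp, D.filKM_FilP (by omega) hg, f - g, ?_, c, hc, by rw [add_sub_cancel]⟩
  exact D.filKM_FilP (by omega) (D.stepB ι hz h0 (by omega) hy h2)
end
end

section
/- (Case n = 1 of the level-q detection Lemma 3.2 / lem:levelq.) Let k be a perfect field of characteristic p, A a smooth k-algebra, q ≥ 0, and let a ∈ Λ^q_A Ω¹_{A/k} be a nonzero element of the q-th exterior power of the module of Kähler differentials. Then there exists a prime ideal P ⊂ A such that the residue field κ(P) has transcendence degree at most q over k and the image of a under the natural map Λ^q_A Ω¹_{A/k} → Λ^q_{κ(P)} Ω¹_{κ(P)/k} (induced by functoriality of Kähler differentials along A → κ(P)) is nonzero. -/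
noncomputable section
open TensorProduct

section ev
variable {R S S' M : Type*} [CommRing R] [CommRing S] [Algebra R S] [CommRing S'] [Algebra R S']
  [AddCommGroup M] [Module R M] {q : ℕ}

def detForm (l : Fin q → (M →ₗ[R] S)) : M [⋀^Fin q]→ₗ[R] S :=
  AlternatingMap.compLinearMap
    (⟨(Matrix.detRowAlternating (R := S) (n := Fin q)).toMultilinearMap.restrictScalars R,
      (Matrix.detRowAlternating (R := S) (n := Fin q)).map_eq_zero_of_eq'⟩ :
      (Fin q → S) [⋀^Fin q]→ₗ[R] S)
    (LinearMap.pi l)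

def evForm (l : Fin q → (M →ₗ[R] S)) : (⋀[R]^q M) →ₗ[R] S :=
  exteriorPower.alternatingMapLinearEquiv (detForm l)

lemma evForm_ιMulti (l : Fin q → (M →ₗ[R] S)) (v : Fin q → M) :
    evForm l (exteriorPower.ιMulti R q v) = Matrix.det (Matrix.of fun j i => l i (v j)) := by
  rw [evForm, exteriorPower.alternatingMapLinearEquiv_apply_ιMulti]
  rfl

lemma evForm_comp (f : S →ₐ[R] S') (l : Fin q → (M →ₗ[R] S)) (a : ⋀[R]^q M) :
    evForm (fun i => f.toLinearMap ∘ₗ l i) a = f (evForm l a) := by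
  have : evForm (fun i => f.toLinearMap ∘ₗ l i) = f.toLinearMap ∘ₗ evForm l := by
    apply exteriorPower.linearMap_ext
    ext v
    simp only [LinearMap.compAlternatingMap_apply, LinearMap.comp_apply, evForm_ιMulti]
    rw [AlgHom.toLinearMap_apply, AlgHom.map_det]
    rfl
  rw [this]; rfl

lemma evForm_sum {ι : Type*} [Fintype ι] (l : Fin q → (M →ₗ[R] S)) (e : ι → (M →ₗ[R] S))
    (c : Fin q → ι → S) (h : ∀ i m, l i m = ∑ j, c i j * e j m) (a : ⋀[R]^q M) :
    evForm l a = ∑ I : Fin q → ι, (∏ i, c i (I i)) * evForm (fun i => e (I i)) a := by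
  classical
  have : evForm l = ∑ I : Fin q → ι, (LinearMap.mulLeft R (∏ i, c i (I i))) ∘ₗ
      evForm (fun i => e (I i)) := by
    apply exteriorPower.linearMap_ext
    ext v
    simp only [LinearMap.compAlternatingMap_apply, LinearMap.sum_apply, LinearMap.comp_apply,
      evForm_ιMulti, LinearMap.mulLeft_apply]
    have h1 : Matrix.det (Matrix.of fun j i => l i (v j)) =
        (Matrix.detRowAlternating (R := S) (n := Fin q)).toMultilinearMap
          (fun i => ∑ j, c i j • (fun t => e j (v t))) := by
      rw [← Matrix.det_transpose]
      change Matrix.det _ = Matrix.det _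
      congr 1
      ext i t
      simp [h]
    rw [h1, MultilinearMap.map_sum]
    refine Finset.sum_congr rfl fun I _ => ?_
    rw [MultilinearMap.map_smul_univ, smul_eq_mul]
    congr 1
    rw [← Matrix.det_transpose]
    rfl
  rw [this]; simp

lemma evForm_eq_zero (l : Fin q → (M →ₗ[R] S)) (h : ¬ Function.Injective l) (a : ⋀[R]^q M) :
    evForm l a = 0 := by
  have : evForm l = 0 := by
    apply exteriorPower.linearMap_ext
    ext v
    simp only [LinearMap.compAlternatingMap_apply, evForm_ιMulti, LinearMap.zero_apply]
    simp only [Function.Injective, not_forall] at h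
    obtain ⟨i, j, hij, hne⟩ := h
    exact Matrix.det_zero_of_column_eq hne (fun t => by simp [hij])
  rw [this]; rfl

lemma exists_evForm_ne_zero [Module.Projective R M] (a : ⋀[R]^q M) (ha : a ≠ 0) :
    ∃ l : Fin q → (M →ₗ[R] R), evForm l a ≠ 0 := by
  classical
  obtain ⟨s, hs⟩ := (Module.projective_def' (R := R) (P := M)).mp inferInstance
  let : LinearOrder M := linearOrderOfSTO (WellOrderingRel)
  let b : Module.Basis M R (M →₀ R) := Finsupp.basisSingleOne
  have h1 : exteriorPower.map q s a ≠ 0 := by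
    intro h
    apply ha
    have h2 : exteriorPower.map q (Finsupp.linearCombination R id) (exteriorPower.map q s a) = a := by
      rw [← LinearMap.comp_apply, ← exteriorPower.map_comp, hs, exteriorPower.map_id]
      rfl
    rw [← h2, h, map_zero]
  have h2 : (b.exteriorPower q).repr (exteriorPower.map q s a) ≠ 0 := by simpa using h1
  obtain ⟨t, ht⟩ := Finsupp.ne_iff.mp h2
  rw [exteriorPower.basis_repr_apply] at ht
  refine ⟨fun i => b.coord (Set.powersetCard.ofFinEmbEquiv.symm t i) ∘ₗ s, ?_⟩
  rw [Finsupp.zero_apply] at ht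
  convert ht using 1
  rw [← LinearMap.comp_apply]
  congr 1
  apply exteriorPower.linearMap_ext
  ext v
  simp only [LinearMap.compAlternatingMap_apply, LinearMap.comp_apply, evForm_ιMulti,
    exteriorPower.map_apply_ιMulti, exteriorPower.ιMultiDual_apply_ιMulti]
  rfl
end ev

section der
variable {k R S N : Type*} [CommRing k] [CommRing R] [CommRing S] [Algebra k S]
  [Algebra R S] [AddCommGroup N] [Module S N] [Module k N]
  [Module R N] [IsScalarTower R S N] 

lemma exists_derivation_extend [Algebra k R] [IsScalarTower k R S] [IsScalarTower k S N] [IsScalarTower k R N] [Algebra.FormallyEtale R S] (d : Derivation k R N) :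
    ∃ d' : Derivation k S N, ∀ r, d' (algebraMap R S r) = d r := by
  let e := KaehlerDifferential.tensorKaehlerEquivOfFormallyEtale k R S
  let f : Ω[S⁄k] →ₗ[S] N := (LinearMap.liftBaseChange S d.liftKaehlerDifferential) ∘ₗ e.symm.toLinearMap
  refine ⟨f.compDer (KaehlerDifferential.D k S), fun r => ?_⟩
  simp [f, e, KaehlerDifferential.tensorKaehlerEquivOfFormallyEtale_symm_D_algebraMap]

lemma derivation_ext_of_formallyUnramified [Algebra.FormallyUnramified R S] (d d' : Derivation k S N)
    (h : ∀ r, d (algebraMap R S r) = d' (algebraMap R S r)) (s : S) : d s = d' s := by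
  let δ : Derivation R S N := Derivation.mk'
    { toFun := fun s => d s - d' s
      map_add' := fun x y => by simp; abel
      map_smul' := fun r x => by
        rw [Algebra.smul_def]
        simp only [Derivation.leibniz, h, RingHom.id_apply, algebraMap_smul, smul_sub]
        abel }
    (fun a b => by simp [smul_sub]; abel)
  have : δ s = 0 := by
    rw [← δ.liftKaehlerDifferential_comp_D s, Subsingleton.elim (KaehlerDifferential.D R S s) 0, map_zero]
  exact sub_eq_zero.mp this
end der

lemma exists_field_of_etale {T B : Type} [CommRing T] [IsDomain T] [CommRing B] [Algebra T B]
    [Algebra.Etale T B] (b : B) (hb : b ≠ 0) :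
    ∃ (F : Type) (_ : Field F) (_ : Algebra T F) (f : B →ₐ[T] F), f b ≠ 0 ∧
      Algebra.FormallyEtale T F ∧ Algebra.IsAlgebraic T F ∧ Function.Injective (algebraMap T F) := by
  let Q := FractionRing T
  let C := Q ⊗[T] B
  obtain ⟨I, _, Ai, _, _, e, hsep⟩ :=
    (Algebra.FormallyEtale.iff_exists_algEquiv_prod Q C).mp inferInstance
  have hinj : Function.Injective (Algebra.TensorProduct.includeRight : B →ₐ[T] C) :=
    Algebra.TensorProduct.includeRight_injective (IsFractionRing.injective T Q)
  have h1 : e (Algebra.TensorProduct.includeRight b) ≠ 0 := by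
    rw [Ne, EmbeddingLike.map_eq_zero_iff]
    intro h
    exact hb (hinj (by rw [h, map_zero]))
  obtain ⟨i, hi⟩ := Function.ne_iff.mp h1
  let : Algebra T (Ai i) := ((algebraMap Q (Ai i)).comp (algebraMap T Q)).toAlgebra
  have : IsScalarTower T Q (Ai i) := IsScalarTower.of_algebraMap_eq fun _ => rfl
  have := hsep i
  let g : C →ₐ[Q] Ai i := (Pi.evalAlgHom Q Ai i).comp e.toAlgHom
  refine ⟨Ai i, inferInstance, inferInstance, (g.restrictScalars T).comp Algebra.TensorProduct.includeRight, hi, ?_, ?_, ?_⟩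
  · have : Algebra.FormallyEtale T Q := Algebra.FormallyEtale.of_isLocalization (nonZeroDivisors T)
    have : Algebra.FormallyEtale Q (Ai i) := Algebra.FormallyEtale.of_isSeparable Q (Ai i)
    exact Algebra.FormallyEtale.comp T Q (Ai i)
  · exact (IsFractionRing.comap_isAlgebraic_iff (A := T) (K := Q) (C := Ai i)).mpr inferInstance
  · exact (algebraMap Q (Ai i)).injective.comp (IsFractionRing.injective T Q)

lemma derivation_ext_of_etale {k A' N : Type*} [CommRing k] [CommRing A'] [Algebra k A'] {n : ℕ}
    [Algebra (MvPolynomial (Fin n) k) A'] [IsScalarTower k (MvPolynomial (Fin n) k) A']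
    [Algebra.FormallyUnramified (MvPolynomial (Fin n) k) A']
    [AddCommGroup N] [Module A' N] [Module k N] [IsScalarTower k A' N]
    (d d' : Derivation k A' N)
    (h : ∀ j, d (algebraMap (MvPolynomial (Fin n) k) A' (MvPolynomial.X j)) =
      d' (algebraMap (MvPolynomial (Fin n) k) A' (MvPolynomial.X j))) (s : A') : d s = d' s := by
  let _ : Module (MvPolynomial (Fin n) k) N :=
    Module.compHom N (algebraMap (MvPolynomial (Fin n) k) A')
  have : IsScalarTower (MvPolynomial (Fin n) k) A' N :=
    IsScalarTower.of_algebraMap_smul fun _ _ => rfl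
  have : IsScalarTower k (MvPolynomial (Fin n) k) N := IsScalarTower.of_algebraMap_smul fun r x => by
    rw [← algebraMap_smul A', ← IsScalarTower.algebraMap_apply, algebraMap_smul]
  have h2 : d.compAlgebraMap (MvPolynomial (Fin n) k) = d'.compAlgebraMap (MvPolynomial (Fin n) k) :=
    MvPolynomial.derivation_ext h
  exact derivation_ext_of_formallyUnramified (R := MvPolynomial (Fin n) k) d d'
    (fun r => DFunLike.congr_fun h2 r) s

lemma exists_point {k A' : Type} [Field k] [CommRing A'] [Algebra k A'] [Algebra.FiniteType k A']
    (h : A') (hh : ¬ IsNilpotent h) : ∃ ψ : A' →ₐ[k] AlgebraicClosure k, ψ h ≠ 0 := by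
  let A'' := Localization.Away h
  have : Nontrivial A'' := by
    by_contra hn
    rw [not_nontrivial_iff_subsingleton] at hn
    have h0 : algebraMap A' A'' 1 = 0 := Subsingleton.elim _ _
    obtain ⟨⟨_, N, rfl⟩, hc⟩ := (IsLocalization.map_eq_zero_iff (Submonoid.powers h) A'' _).mp h0
    exact hh ⟨N, by simpa using hc⟩
  have : Algebra.FinitePresentation A' A'' := IsLocalization.Away.finitePresentation h
  have : Algebra.FiniteType k A'' := Algebra.FiniteType.trans (S := A') inferInstance inferInstance
  obtain ⟨m, hm⟩ := Ideal.exists_maximal A''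
  let _ : Field (A'' ⧸ m) := Ideal.Quotient.field m
  have : Module.Finite k (A'' ⧸ m) := finite_of_finite_type_of_isJacobsonRing k (A'' ⧸ m)
  let ψ : (A'' ⧸ m) →ₐ[k] AlgebraicClosure k := IsAlgClosed.lift
  refine ⟨(ψ.comp (Ideal.Quotient.mkₐ k m)).comp (IsScalarTower.toAlgHom k A' A''), ?_⟩
  exact (((IsLocalization.Away.algebraMap_isUnit (S := A'') h).map
    (ψ.comp (Ideal.Quotient.mkₐ k m)))).ne_zero

lemma tmul_ne_zero_of_point {R T A' L : Type*} [CommRing R] [CommRing T] [CommRing A'] [CommRing L]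
    [Algebra R T] [Algebra R A'] (p1 : T →+* L) (ψ : A' →+* L)
    (h : ∀ r, p1 (algebraMap R T r) = ψ (algebraMap R A' r)) (c : A') (hc : ψ c ≠ 0) :
    (1 : T) ⊗ₜ[R] c ≠ 0 := by
  let _ : Algebra R L := (ψ.comp (algebraMap R A')).toAlgebra
  let p1' : T →ₐ[R] L := { p1 with commutes' := h }
  let p2' : A' →ₐ[R] L := { ψ with commutes' := fun r => rfl }
  let pt : T ⊗[R] A' →ₐ[R] L := Algebra.TensorProduct.lift p1' p2' (fun _ _ => .all _ _)
  intro h0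
  apply hc
  have : pt ((1 : T) ⊗ₜ[R] c) = ψ c := by
    simp only [pt, Algebra.TensorProduct.lift_tmul, map_one, one_mul]
    rfl
  rw [← this, h0, map_zero]

lemma exists_slice {k A' L : Type} [Field k] [Field L] [Algebra k L] [Algebra.IsAlgebraic k L]
    [CommRing A'] [Algebra k A'] {n q : ℕ}
    [Algebra (MvPolynomial (Fin n) k) A'] [IsScalarTower k (MvPolynomial (Fin n) k) A']
    [Algebra.Etale (MvPolynomial (Fin n) k) A'] (ψ : A' →ₐ[k] L) (I : Fin q → Fin n)
    (hI : Function.Injective I) (c : A') (hc : ψ c ≠ 0) :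
    ∃ (F : Type) (_ : Field F) (_ : Algebra k F) (φ : A' →ₐ[k] F),
      (∀ s : Finset F, (AlgebraicIndependent k fun x : s => (x : F)) → s.card ≤ q) ∧
      φ c ≠ 0 ∧ ∃ δ : Fin q → Derivation k F F, ∀ i j,
        δ i (φ (algebraMap (MvPolynomial (Fin n) k) A' (MvPolynomial.X j))) =
          if j = I i then 1 else 0 := by
  classical
  let x : Fin n → A' := fun j => algebraMap (MvPolynomial (Fin n) k) A' (MvPolynomial.X j)
  let T := MvPolynomial (Fin q) L
  let y : Fin n → T := fun j => if h : ∃ i, I i = j then MvPolynomial.X h.choose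
    else MvPolynomial.C (ψ (x j))
  have hy1 : ∀ i, y (I i) = MvPolynomial.X i := fun i => by
    have h : ∃ i', I i' = I i := ⟨i, rfl⟩
    simp only [y, dif_pos h]
    rw [hI h.choose_spec]
  have hy2 : ∀ j, (∀ i, I i ≠ j) → y j = MvPolynomial.C (ψ (x j)) := fun j h => by
    simp only [y]
    rw [dif_neg (by simpa using h)]
  let yhom : MvPolynomial (Fin n) k →ₐ[k] T := MvPolynomial.aeval y
  let _ : Algebra (MvPolynomial (Fin n) k) T := yhom.toRingHom.toAlgebra
  have : IsScalarTower k (MvPolynomial (Fin n) k) T :=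
    IsScalarTower.of_algebraMap_eq fun r => (yhom.commutes r).symm
  let B := T ⊗[MvPolynomial (Fin n) k] A'
  let p1 : T →ₐ[L] L := MvPolynomial.aeval fun i => ψ (x (I i))
  have hp1y : ∀ j, p1 (y j) = ψ (x j) := fun j => by
    by_cases h : ∃ i, I i = j
    · obtain ⟨i, rfl⟩ := h
      rw [hy1]; exact MvPolynomial.aeval_X _ i
    · push Not at h
      rw [hy2 j h]; exact MvPolynomial.aeval_C _ _
  have hp1 : (p1.restrictScalars k).comp yhom =
      ψ.comp (IsScalarTower.toAlgHom k (MvPolynomial (Fin n) k) A') := by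
    apply MvPolynomial.algHom_ext
    intro j
    simp [yhom, hp1y, x]
  have hb : (1 : T) ⊗ₜ[MvPolynomial (Fin n) k] c ≠ 0 :=
    tmul_ne_zero_of_point p1.toRingHom ψ.toRingHom (fun r => DFunLike.congr_fun hp1 r) c hc
  obtain ⟨F, _, _, f, hf, het, halg, hinj⟩ := exists_field_of_etale (T := T) (B := B) _ hb
  let _ : Algebra L F := ((algebraMap T F).comp (algebraMap L T)).toAlgebra
  have : IsScalarTower L T F := IsScalarTower.of_algebraMap_eq fun _ => rfl
  let _ : Algebra k F := ((algebraMap L F).comp (algebraMap k L)).toAlgebra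
  have : IsScalarTower k L F := IsScalarTower.of_algebraMap_eq fun _ => rfl
  have : IsScalarTower k T F := IsScalarTower.of_algebraMap_eq fun _ => rfl
  let φ : A' →ₐ[k] F :=
    { f.toRingHom.comp (Algebra.TensorProduct.includeRight (R := MvPolynomial (Fin n) k)
        (A := T) (B := A')).toRingHom with
      commutes' := fun r => by
        change f ((1 : T) ⊗ₜ[MvPolynomial (Fin n) k] algebraMap k A' r) = _
        rw [IsScalarTower.algebraMap_apply k (MvPolynomial (Fin n) k) A',
          Algebra.algebraMap_eq_smul_one (R := MvPolynomial (Fin n) k) (A := A'),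
          ← TensorProduct.smul_tmul,
          ← Algebra.algebraMap_eq_smul_one, ← IsScalarTower.algebraMap_apply k,
          IsScalarTower.algebraMap_apply k T F]
        exact f.commutes _ }
  have hφx : ∀ j, φ (x j) = algebraMap T F (y j) := fun j => by
    change f ((1 : T) ⊗ₜ[MvPolynomial (Fin n) k] x j) = _
    simp only [x]
    rw [Algebra.algebraMap_eq_smul_one (R := MvPolynomial (Fin n) k) (A := A'),
          ← TensorProduct.smul_tmul, ← Algebra.algebraMap_eq_smul_one]
    have : algebraMap (MvPolynomial (Fin n) k) T (MvPolynomial.X j) = y j :=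
      MvPolynomial.aeval_X y j
    rw [this]
    exact f.commutes _
  refine ⟨F, inferInstance, inferInstance, φ, ?_, hf, ?_⟩
  · intro s hs
    have : FaithfulSMul T F := (faithfulSMul_iff_algebraMap_injective T F).mpr hinj
    have h1 := hs.cardinalMk_le_trdeg
    have h2 := _root_.trdeg_add_eq k L (A := F)
    have h3 := _root_.trdeg_add_eq L T (A := F)
    rw [trdeg_eq_zero (R := T) (A := F), add_zero, MvPolynomial.trdeg_of_isDomain] at h3
    rw [trdeg_eq_zero (R := k) (A := L), zero_add, ← h3] at h2
    rw [← h2] at h1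
    simpa using h1
  · have hd : ∀ i : Fin q, ∃ d : Derivation L F F, ∀ t : T,
        d (algebraMap T F t) = algebraMap T F (MvPolynomial.pderiv i t) := fun i =>
      exists_derivation_extend ((Algebra.linearMap T F).compDer (MvPolynomial.pderiv i))
    choose d hd using hd
    refine ⟨fun i => (d i).restrictScalars k, fun i j => ?_⟩
    change d i (φ (x j)) = _
    rw [hφx, hd]
    by_cases h : ∃ i', I i' = j
    · obtain ⟨i', rfl⟩ := h
      rw [hy1, MvPolynomial.pderiv_X]
      by_cases hii : i' = i
      · subst hii; simp
      · rw [if_neg (fun h => hii (hI h)), Pi.single_eq_of_ne hii, map_zero]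
    · push Not at h
      rw [hy2 j h, if_neg (fun h' => h i h'.symm)]
      simp

lemma derivation_sum_apply {k A N ι : Type*} [CommRing k] [CommRing A] [Algebra k A]
    [AddCommGroup N] [Module A N] [Module k N] (s : Finset ι) (d : ι → Derivation k A N) (x : A) :
    (∑ i ∈ s, d i) x = ∑ i ∈ s, d i x := by
  classical
  induction s using Finset.induction_on with
  | empty => simp
  | insert i s hi ih => rw [Finset.sum_insert hi, Finset.sum_insert hi, Derivation.add_apply, ih]

lemma linearMap_ext_kaehler {k A N : Type*} [CommRing k] [CommRing A] [Algebra k A]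
    [AddCommGroup N] [Module A N] (f g : Ω[A⁄k] →ₗ[A] N)
    (h : ∀ x, f (KaehlerDifferential.D k A x) = g (KaehlerDifferential.D k A x)) : f = g := by
  apply LinearMap.ext_on (KaehlerDifferential.span_range_derivation k A)
  rintro _ ⟨x, rfl⟩
  exact h x

lemma exists_mem_span_form {k A : Type*} [CommRing k] [CommRing A] [Algebra k A] {q : ℕ}
    (a : ⋀[A]^q (Ω[A⁄k])) : ∃ (n : ℕ) (b : Fin n → A) (w : Fin n → Fin q → A),
      a = ∑ t, b t • exteriorPower.ιMulti A q (fun i => KaehlerDifferential.D k A (w t i)) := by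
  have h := exteriorPower.ιMulti_span_of_span A q (Ω[A⁄k])
    (KaehlerDifferential.span_range_derivation k A)
  have ha : a ∈ (⊤ : Submodule A (⋀[A]^q (Ω[A⁄k]))) := trivial
  rw [← h, Submodule.mem_span_set'] at ha
  obtain ⟨n, b, v, rfl⟩ := ha
  have hv : ∀ t, ∃ w : Fin q → A, exteriorPower.ιMulti A q
      (fun i => KaehlerDifferential.D k A (w i)) = (v t : ⋀[A]^q (Ω[A⁄k])) := fun t => by
    obtain ⟨u, hu, huv⟩ := (v t).2
    have : ∀ i, ∃ w, KaehlerDifferential.D k A w = u i := fun i => hu ⟨i, rfl⟩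
    choose w hw using this
    refine ⟨w, ?_⟩
    rw [← huv]
    congr 1
    funext i
    exact hw i
  choose w hw using hv
  exact ⟨n, b, w, by simp only [hw]⟩

theorem statement14 (p : ℕ) (hp : p.Prime)
    (k : Type) [Field k] [CharP k p] [PerfectField k]
    (A : Type) [CommRing A] [Algebra k A] [Algebra.Smooth k A]
    (q : ℕ) (a : ⋀[A]^q (Ω[A⁄k])) (ha : a ≠ 0) :
    ∃ (F : Type) (_ : Field F) (_ : Algebra k F) (φ : A →ₐ[k] F),
      (∀ s : Finset F, (AlgebraicIndependent k fun x : s => (x : F)) → s.card ≤ q) ∧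
      ∀ g : (⋀[A]^q (Ω[A⁄k])) →+ (⋀[F]^q (Ω[F⁄k])),
        (∀ (b : A) (w : Fin q → A)
            (hmem : b • ExteriorAlgebra.ιMulti A q (fun i => KaehlerDifferential.D k A (w i)) ∈
              ⋀[A]^q (Ω[A⁄k])),
            (g ⟨_, hmem⟩ : ExteriorAlgebra F (Ω[F⁄k])) =
              φ b • ExteriorAlgebra.ιMulti F q (fun i => KaehlerDifferential.D k F (φ (w i)))) →
        g a ≠ 0 := by
  classical
  obtain ⟨l, hl⟩ := exists_evForm_ne_zero a ha
  set h := evForm l a with hh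
  -- a chart around a point of the support of `h`
  obtain ⟨m, hm, hle⟩ := Ideal.exists_le_maximal (LinearMap.ker (LinearMap.mulRight A h))
    (fun e => hl (by
      have : (1 : A) ∈ LinearMap.ker (LinearMap.mulRight A h) := by rw [e]; trivial
      simpa using this))
  have : Algebra.IsSmoothAt k m := by
    have : Algebra.FormallySmooth A (Localization.AtPrime m) := Algebra.FormallySmooth.of_isLocalization m.primeCompl
    exact Algebra.FormallySmooth.comp k A (Localization.AtPrime m)
  obtain ⟨f, hfm, n, _, _, _⟩ :=
    Algebra.IsSmoothAt.exists_isStandardEtale_mvPolynomial (R := k) (p := m)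
  set A' := Localization.Away f with hA'
  have : Algebra.Etale (MvPolynomial (Fin n) k) A' := inferInstance
  have hne : algebraMap A A' h ≠ 0 := by
    intro h0
    obtain ⟨⟨_, N, rfl⟩, hc⟩ := (IsLocalization.map_eq_zero_iff (Submonoid.powers f) A' _).mp h0
    exact hfm (hm.isPrime.mem_of_pow_mem N (hle (by simpa using hc)))
  have hnil : ¬ IsNilpotent (algebraMap A A' h) := by
    obtain ⟨F, _, _, f, hf, -⟩ := exists_field_of_etale (T := MvPolynomial (Fin n) k) _ hne
    intro hn
    exact hf (hn.map f).eq_zero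
  have : Algebra.FiniteType k A' :=
    Algebra.FiniteType.trans (S := MvPolynomial (Fin n) k) inferInstance inferInstance
  obtain ⟨ψ, hψ⟩ := exists_point (k := k) _ hnil
  -- coordinate derivations
  let x : Fin n → A' := fun j => algebraMap (MvPolynomial (Fin n) k) A' (MvPolynomial.X j)
  have hE : ∀ j : Fin n, ∃ d : Derivation k A' A', ∀ t : MvPolynomial (Fin n) k,
      d (algebraMap _ A' t) = algebraMap _ A' (MvPolynomial.pderiv j t) := fun j =>
    exists_derivation_extend
      ((Algebra.linearMap (MvPolynomial (Fin n) k) A').compDer (MvPolynomial.pderiv j))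
  choose E hE using hE
  have hEx : ∀ i j, E j (x i) = if i = j then 1 else 0 := fun i j => by
    simp only [x]
    rw [hE, MvPolynomial.pderiv_X]
    by_cases hij : i = j
    · subst hij; simp
    · rw [if_neg hij, Pi.single_eq_of_ne hij, map_zero]
  have : Algebra.FormallyEtale A A' := Algebra.FormallyEtale.of_isLocalization (Submonoid.powers f)
  have hd : ∀ i : Fin q, ∃ d : Derivation k A' A', ∀ r : A,
      d (algebraMap A A' r) = algebraMap A A' (l i (KaehlerDifferential.D k A r)) := fun i =>
    exists_derivation_extend
      ((Algebra.linearMap A A').compDer ((l i).compDer (KaehlerDifferential.D k A)))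
  choose d hd using hd
  have hdE : ∀ i s, d i s = ∑ j, d i (x j) * E j s := fun i s => by
    have := derivation_ext_of_etale (n := n) (d i) (∑ j, d i (x j) • E j) (fun j => by
      change d i (x j) = (∑ j, d i (x j) • E j : Derivation k A' A') (x j)
      rw [derivation_sum_apply]
      simp [hEx]) s
    rw [this, derivation_sum_apply]
    simp
  let e : Fin n → (Ω[A⁄k] →ₗ[A] A') := fun j => ((E j).compAlgebraMap A).liftKaehlerDifferential
  have heD : ∀ j r, e j (KaehlerDifferential.D k A r) = E j (algebraMap A A' r) := fun j r =>
    Derivation.liftKaehlerDifferential_comp_D _ _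
  have hsum : algebraMap A A' h = ∑ I : Fin q → Fin n, (∏ i, d i (x (I i))) *
      evForm (fun i => e (I i)) a := by
    rw [← evForm_sum (fun i => (Algebra.ofId A A').toLinearMap ∘ₗ l i) e (fun i j => d i (x j)),
      evForm_comp]
    · rfl
    · intro i m
      have : (Algebra.ofId A A').toLinearMap ∘ₗ l i = ∑ j, (LinearMap.mulLeft A (d i (x j))) ∘ₗ e j := by
        apply linearMap_ext_kaehler
        intro r
        rw [LinearMap.sum_apply]
        simp only [LinearMap.comp_apply, LinearMap.mulLeft_apply, heD]
        rw [← hdE, hd]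
        rfl
      rw [this, LinearMap.sum_apply]
      rfl
  obtain ⟨I, hI⟩ : ∃ I : Fin q → Fin n, ψ (evForm (fun i => e (I i)) a) ≠ 0 := by
    by_contra! hcon
    apply hψ
    rw [hsum, map_sum]
    exact Finset.sum_eq_zero fun I _ => by rw [map_mul, hcon, mul_zero]
  have hIinj : Function.Injective I := by
    by_contra hn
    apply hI
    rw [evForm_eq_zero, map_zero]
    exact fun hi => hn (fun s t hst => hi (by simp only [hst]))
  obtain ⟨F, _, _, φ, htr, hφ, δ, hδ⟩ := exists_slice ψ I hIinj _ hI
  refine ⟨F, inferInstance, inferInstance, φ.comp (IsScalarTower.toAlgHom k A A'), htr, ?_⟩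
  intro g hg hga
  apply hφ
  let _ : Algebra A' F := φ.toRingHom.toAlgebra
  have : IsScalarTower k A' F := IsScalarTower.of_algebraMap_eq fun r => (φ.commutes r).symm
  have hδE : ∀ i s, δ i (φ s) = φ (E (I i) s) := fun i s =>
    derivation_ext_of_etale (n := n) ((δ i).compAlgebraMap A')
      ((Algebra.linearMap A' F).compDer (E (I i))) (fun j => by
        refine (hδ i j).trans ?_
        change _ = φ (E (I i) (x j))
        rw [hEx]
        split_ifs <;> simp) s
  let m' : Fin q → (Ω[F⁄k] →ₗ[F] F) := fun i => (δ i).liftKaehlerDifferential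
  have key : evForm m' (g a) = φ (evForm (fun i => e (I i)) a) := by
    obtain ⟨N, b, w, rfl⟩ := exists_mem_span_form a
    simp only [map_sum]
    refine Finset.sum_congr rfl fun t _ => ?_
    have h1 : g (b t • exteriorPower.ιMulti A q (fun i => KaehlerDifferential.D k A (w t i))) =
        φ (algebraMap A A' (b t)) • exteriorPower.ιMulti F q
          (fun i => KaehlerDifferential.D k F (φ (algebraMap A A' (w t i)))) :=
      Subtype.ext (hg (b t) (w t) (Submodule.coe_mem (b t • exteriorPower.ιMulti A q (fun i => KaehlerDifferential.D k A (w t i)))))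
    rw [h1, map_smul, map_smul, evForm_ιMulti, evForm_ιMulti, smul_eq_mul, Algebra.smul_def, map_mul,
      AlgHom.map_det]
    congr 2
    ext j i
    simp only [m', Matrix.of_apply, AlgHom.mapMatrix_apply, Matrix.map_apply, heD]
    rw [Derivation.liftKaehlerDifferential_comp_D, hδE]
  rw [← key, hga, map_zero]
end
end
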